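/- Let (p^(1), p^(2)) and (q^(1), q^(2)) be dichotomies. If D_α(p^(1)‖p^(2)) > D_α(q^(1)‖q^(2)) for every α ∈ [0,∞) and for α = ∞, then: (a) there exist a stochastic matrix T and a dichotomy (r^(1), r^(2)) such that T(r^(k) ⊗ p^(k)) = r^(k) ⊗ q^(k) for k = 1, 2; moreover there is n ∈ ℕ for which one may take r^(k) = (1/(n+1)) ⊕_{ℓ=0}^{n} (q^(k))^{⊗ℓ} ⊗ (p^(k))^{⊗(n−ℓ)}; (b) for all sufficiently large n there exists a stochastic matrix T_n with T_n (p^(k))^{⊗n} = (q^(k))^{⊗n} for k = 1, 2. Conversely, if (a) holds for some stochastic T and some dichotomy (r^(1), r^(2)), or (b) holds for some n ≥ 1, then D_α(p^(1)‖p^(2)) ≥ D_α(q^(1)‖q^(2)) for every α ∈ [0,∞) and for α = ∞. -/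

import Mathlib

open Classical

noncomputable section

/-- `p` is a probability vector. -/
def IsProb {I : Type} [Fintype I] (p : I → ℝ) : Prop :=
  (∀ x, 0 ≤ p x) ∧ ∑ x, p x = 1

/-- `T` is a (column-)stochastic matrix (`T y x` is the entry in row `y`, column `x`). -/
def IsStoch {I J : Type} [Fintype I] [Fintype J] (T : J → I → ℝ) : Prop :=
  (∀ y x, 0 ≤ T y x) ∧ ∀ x, ∑ y, T y x = 1

/-- Kronecker product of two vectors. -/
def kron {I J : Type} (p : I → ℝ) (q : J → ℝ) : I × J → ℝ := fun x => p x.1 * q x.2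

/-- `n`-fold Kronecker power `p^{⊗n}`. -/
def kpow {I : Type} (p : I → ℝ) (n : ℕ) : (Fin n → I) → ℝ := fun f => ∏ j, p (f j)

/-- Index type of the catalyst `⊕_{ℓ=0}^{n} (q)^{⊗ℓ} ⊗ (p)^{⊗(n-ℓ)}`
(`I` indexes `p`, `J` indexes `q`). -/
abbrev CatIdx (I J : Type) (n : ℕ) : Type :=
  (ℓ : Fin (n + 1)) × ((Fin (ℓ : ℕ) → J) × (Fin (n - (ℓ : ℕ)) → I))

/-- The catalyst `r = (1/(n+1)) ⊕_{ℓ=0}^{n} q^{⊗ℓ} ⊗ p^{⊗(n-ℓ)}`. -/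
def catVec {I J : Type} (n : ℕ) (p : I → ℝ) (q : J → ℝ) : CatIdx I J n → ℝ :=
  fun x => (1 / (n + 1 : ℝ)) * ((∏ j, q (x.2.1 j)) * ∏ j, p (x.2.2 j))

/-- The multivariate monotone `Φ_{α,C}` (convention `0^0 = 1` of `rpow`). -/
def phiAC {I : Type} [Fintype I] (d : ℕ) (α : Fin d → ℝ) (C : Finset (Fin d))
    (p : Fin d → I → ℝ) : ℝ :=
  ∑ x ∈ Finset.univ.filter (fun x => ∀ c ∈ C, p c x ≠ 0), ∏ k, p k x ^ α k

/-- The standard basis vector `e_k` of `ℝ^d`. -/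
def stdBasis (d : ℕ) (k : Fin d) : Fin d → ℝ := fun j => if j = k then 1 else 0

/-- ℓ¹-distance of vectors. -/
def dist1 {I : Type} [Fintype I] (p q : I → ℝ) : ℝ := ∑ x, |p x - q x|

/-- A dichotomy: a pair of probability vectors with `supp p ⊆ supp q`. -/
def IsDichotomy {I : Type} [Fintype I] (p q : I → ℝ) : Prop :=
  IsProb p ∧ IsProb q ∧ ∀ x, p x ≠ 0 → q x ≠ 0

/-- The Rényi divergence `D_α(p‖q)` for `α ∈ [0,∞)`, with values in `EReal`
(`⊤` encodes `+∞`; all divergences are `⊤` if `supp p ∩ supp q = ∅`). -/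
def renyi {I : Type} [Fintype I] (α : ℝ) (p q : I → ℝ) : EReal :=
  if ¬ ∃ x, p x ≠ 0 ∧ q x ≠ 0 then ⊤
  else if α = 0 then
    ((-Real.log (∑ x ∈ Finset.univ.filter (fun x => p x ≠ 0 ∧ q x ≠ 0), q x) : ℝ) : EReal)
  else if α < 1 then
    (((α - 1)⁻¹ * Real.log (∑ x ∈ Finset.univ.filter (fun x => p x ≠ 0 ∧ q x ≠ 0),
        p x ^ α * q x ^ (1 - α)) : ℝ) : EReal)
  else if α = 1 then
    if ∀ x, p x ≠ 0 → q x ≠ 0 then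
      ((∑ x ∈ Finset.univ.filter (fun x => p x ≠ 0), p x * Real.log (p x / q x) : ℝ) : EReal)
    else ⊤
  else
    if ∀ x, p x ≠ 0 → q x ≠ 0 then
      (((α - 1)⁻¹ * Real.log (∑ x ∈ Finset.univ.filter (fun x => p x ≠ 0),
          p x ^ α * q x ^ (1 - α)) : ℝ) : EReal)
    else ⊤

/-- The max divergence `D_∞(p‖q)`, with values in `EReal`. -/
def renyiTop {I : Type} [Fintype I] (p q : I → ℝ) : EReal :=
  if h : ∃ x, p x ≠ 0 ∧ q x ≠ 0 then
    if ∀ x, p x ≠ 0 → q x ≠ 0 then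
      ((Real.log ((Finset.univ.filter fun x => p x ≠ 0).sup'
        ⟨h.choose, Finset.mem_filter.mpr ⟨Finset.mem_univ _, h.choose_spec.1⟩⟩
        fun x => p x / q x) : ℝ) : EReal)
    else ⊤
  else ⊤

lemma sum_sup'_hinge {I J ι : Type} [Fintype I] [Fintype J]
    {p₁ p₂ : I → ℝ} {q₁ q₂ : J → ℝ} (hp : ∀ x, 0 ≤ p₂ x) (hq : ∀ y, 0 ≤ q₂ y)
    (h₁ : ∑ x, p₁ x = ∑ y, q₁ y) (h₂ : ∑ x, p₂ x = ∑ y, q₂ y)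
    (h : ∀ t : ℝ, ∑ y, max (q₁ y - t * q₂ y) 0 ≤ ∑ x, max (p₁ x - t * p₂ x) 0)
    (m b : ι → ℝ) (S : Finset ι) (hS : S.Nonempty) :
    ∑ y, S.sup' hS (fun i => m i * q₁ y + b i * q₂ y) ≤
      ∑ x, S.sup' hS (fun i => m i * p₁ x + b i * p₂ x) := by
  induction S using Finset.strongInduction with
  | H S ih =>
  obtain ⟨k', hk'S, hk'⟩ := S.exists_max_image m hS
  obtain ⟨k, hk, hkb⟩ := (S.filter fun i => m i = m k').exists_max_image b ⟨k', by simp [hk'S]⟩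
  simp only [Finset.mem_filter] at hk hkb
  have hkm : ∀ i ∈ S, m i ≤ m k := fun i hi => hk.2 ▸ hk' i hi
  have hkb' : ∀ i ∈ S, m i = m k → b i ≤ b k := fun i hi e => hkb i ⟨hi, e.trans hk.2⟩
  by_cases hS' : (S.filter fun i => m i < m k).Nonempty
  · obtain ⟨j, hj, hjt⟩ := (S.filter fun i => m i < m k).exists_max_image
      (fun i => (b i - b k) / (m k - m i)) hS'
    simp only [Finset.mem_filter] at hj hjt
    set t := (b j - b k) / (m k - m j) with ht
    have hjS : (S.filter fun i => m i ≤ m j).Nonempty := ⟨j, by simp [hj.1]⟩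
    have htj : (m k - m j) * t = b j - b k := by
      rw [ht]; field_simp [(sub_pos.2 hj.2).ne']
    have hti : ∀ i ∈ S, m i < m k → b i - b k ≤ (m k - m i) * t := by
      intro i hi him
      have := hjt i ⟨hi, him⟩
      rw [div_le_iff₀ (sub_pos.2 him)] at this
      linarith
    have key : ∀ u v : ℝ, 0 ≤ v → S.sup' hS (fun i => m i * u + b i * v) =
        (S.filter fun i => m i ≤ m j).sup' hjS (fun i => m i * u + b i * v) +
          (m k - m j) * max (u - t * v) 0 := by
      intro u v hv
      have hkj := hj.2
      have htjv : (m k - m j) * t * v = (b j - b k) * v := by rw [htj]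
      rcases le_total (t * v) u with huv | huv
      · rw [max_eq_left (by linarith)]
        have e1 : S.sup' hS (fun i => m i * u + b i * v) = m k * u + b k * v := by
          apply le_antisymm
          · apply Finset.sup'_le
            intro i hi
            rcases (hkm i hi).lt_or_eq with him | him
            · nlinarith [mul_le_mul_of_nonneg_right (hti i hi him) hv,
                mul_le_mul_of_nonneg_left huv (sub_pos.2 him).le]
            · rw [him]; gcongr; exact hkb' i hi him
          · exact Finset.le_sup' (fun i => m i * u + b i * v) hk.1
        have e2 : (S.filter fun i => m i ≤ m j).sup' hjS (fun i => m i * u + b i * v) =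
            m j * u + b j * v := by
          apply le_antisymm
          · apply Finset.sup'_le
            intro i hi
            simp only [Finset.mem_filter] at hi
            nlinarith [mul_le_mul_of_nonneg_right (hti i hi.1 (hi.2.trans_lt hkj)) hv,
              mul_le_mul_of_nonneg_left huv (sub_nonneg.2 hi.2)]
          · exact Finset.le_sup' (fun i => m i * u + b i * v) (by simp [hj.1])
        rw [e1, e2]
        linarith
      · rw [max_eq_right (by linarith), mul_zero, add_zero]
        apply le_antisymm
        · apply Finset.sup'_le
          intro i hi
          rcases le_or_gt (m i) (m j) with him | him
          · exact Finset.le_sup' (fun i => m i * u + b i * v) (by simp [hi, him])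
          · refine le_trans ?_
              (Finset.le_sup' (fun i => m i * u + b i * v) (show j ∈ _ by simp [hj.1]))
            have hbt : b i - b j ≤ (m j - m i) * t := by
              rcases (hkm i hi).lt_or_eq with hik | hik
              · linarith [hti i hi hik]
              · have := hkb' i hi hik
                rw [hik]; linarith
            nlinarith [mul_le_mul_of_nonneg_right hbt hv,
              mul_le_mul_of_nonneg_left huv (sub_pos.2 him).le]
        · exact Finset.sup'_mono _ (Finset.filter_subset _ _) _
    have hss : (S.filter fun i => m i ≤ m j) ⊂ S := by
      refine Finset.filter_ssubset.2 ⟨k, hk.1, not_le.2 hj.2⟩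
    rw [Finset.sum_congr rfl fun y _ => key _ _ (hq y),
      Finset.sum_congr rfl fun x _ => key _ _ (hp x), Finset.sum_add_distrib,
      Finset.sum_add_distrib, ← Finset.mul_sum, ← Finset.mul_sum]
    exact add_le_add (ih _ hss hjS)
      (mul_le_mul_of_nonneg_left (h t) (sub_pos.2 hj.2).le)
  · have key : ∀ u v : ℝ, 0 ≤ v → S.sup' hS (fun i => m i * u + b i * v) =
        m k * u + b k * v := by
      intro u v hv
      apply le_antisymm
      · apply Finset.sup'_le
        intro i hi
        have him : m i = m k := by
          by_contra hne
          exact hS' ⟨i, by simp [hi, lt_of_le_of_ne (hkm i hi) hne]⟩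
        rw [him]; gcongr; exact hkb' i hi him
      · exact Finset.le_sup' (fun i => m i * u + b i * v) hk.1
    rw [Finset.sum_congr rfl fun y _ => key _ _ (hq y),
      Finset.sum_congr rfl fun x _ => key _ _ (hp x), Finset.sum_add_distrib,
      Finset.sum_add_distrib, ← Finset.mul_sum, ← Finset.mul_sum, ← Finset.mul_sum,
      ← Finset.mul_sum, h₁, h₂]

/-- Blackwell's theorem for pairs of vectors: comparison of all hinge sums yields a
stochastic matrix. -/
lemma exists_stoch_of_hinge {I J : Type} [Fintype I] [Fintype J]
    {p₁ p₂ : I → ℝ} {q₁ q₂ : J → ℝ} (hp₁ : IsProb p₁) (hp₂ : IsProb p₂)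
    (hq₁ : IsProb q₁) (hq₂ : IsProb q₂)
    (h : ∀ t : ℝ, 0 ≤ t →
      ∑ y, max (q₁ y - t * q₂ y) 0 ≤ ∑ x, max (p₁ x - t * p₂ x) 0) :
    ∃ T : J → I → ℝ, IsStoch T ∧ (∀ y, ∑ x, T y x * p₁ x = q₁ y) ∧
      (∀ y, ∑ x, T y x * p₂ x = q₂ y) := by
  have h' : ∀ t : ℝ, ∑ y, max (q₁ y - t * q₂ y) 0 ≤ ∑ x, max (p₁ x - t * p₂ x) 0 := by
    intro t
    rcases le_total 0 t with ht | ht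
    · exact h t ht
    · rw [Finset.sum_congr rfl fun y _ => max_eq_left (by
          nlinarith [hq₁.1 y, mul_nonneg (neg_nonneg.2 ht) (hq₂.1 y)]),
        Finset.sum_congr rfl fun x _ => max_eq_left (by
          nlinarith [hp₁.1 x, mul_nonneg (neg_nonneg.2 ht) (hp₂.1 x)]),
        Finset.sum_sub_distrib, Finset.sum_sub_distrib, ← Finset.mul_sum, ← Finset.mul_sum,
        hp₁.2, hp₂.2, hq₁.2, hq₂.2]
  let Φ : (I → J → ℝ) → (J → ℝ) × (J → ℝ) :=
    fun T => (fun y => ∑ x, T x y * p₁ x, fun y => ∑ x, T x y * p₂ x)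
  let K : Set (I → J → ℝ) := Set.univ.pi fun _ => stdSimplex ℝ J
  have hKc : IsCompact K := isCompact_univ_pi fun _ => isCompact_stdSimplex ℝ J
  have hKv : Convex ℝ K := convex_pi fun _ _ => convex_stdSimplex ℝ J
  have hΦc : Continuous Φ := by fun_prop
  have hΦl : IsLinearMap ℝ Φ := by
    constructor
    · intro S T
      ext y <;> simp [Φ, add_mul, Finset.sum_add_distrib]
    · intro c T
      ext y <;> simp [Φ, mul_assoc, Finset.mul_sum]
  by_cases hmem : (q₁, q₂) ∈ Φ '' K
  · obtain ⟨T, hT, hTq⟩ := hmem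
    refine ⟨fun y x => T x y, ⟨fun y x => (hT x trivial).1 y, fun x => (hT x trivial).2⟩, ?_, ?_⟩
    · intro y; exact congrFun (congrArg Prod.fst hTq) y
    · intro y; exact congrFun (congrArg Prod.snd hTq) y
  exfalso
  obtain ⟨f, u, hfu, huf⟩ := geometric_hahn_banach_closed_point
    (hKv.is_linear_image hΦl) (hKc.image hΦc).isClosed hmem
  set m : J → ℝ := fun y => f (Pi.single y 1, 0) with hm
  set b : J → ℝ := fun y => f (0, Pi.single y 1) with hb
  have hf : ∀ v w : J → ℝ, f (v, w) = ∑ y, (m y * v y + b y * w y) := by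
    intro v w
    have e : (v, w) = ∑ y, (v y • ((Pi.single y 1 : J → ℝ), (0 : J → ℝ)) +
        w y • ((0 : J → ℝ), (Pi.single y 1 : J → ℝ))) := by
      ext z <;> simp [Prod.fst_sum, Prod.snd_sum, Finset.sum_apply, Pi.single_apply]
    rw [e, map_sum]
    refine Finset.sum_congr rfl fun y _ => ?_
    rw [map_add, map_smul, map_smul, smul_eq_mul, smul_eq_mul, mul_comm (v y), mul_comm (w y)]
  have hJ : (Finset.univ : Finset J).Nonempty := by
    by_contra hne
    have := hq₁.2
    rw [Finset.not_nonempty_iff_eq_empty.1 hne] at this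
    simp at this
  have hbest : ∀ x, ∃ y, ∀ z, m z * p₁ x + b z * p₂ x ≤ m y * p₁ x + b y * p₂ x := by
    intro x
    obtain ⟨y, -, hy⟩ := Finset.univ.exists_max_image (fun z => m z * p₁ x + b z * p₂ x) hJ
    exact ⟨y, fun z => hy z (Finset.mem_univ _)⟩
  choose y₀ hy₀ using hbest
  have hT : (fun x => Pi.single (y₀ x) 1 : I → J → ℝ) ∈ K := by
    intro x _
    exact single_mem_stdSimplex ℝ _
  have hlt := hfu _ ⟨_, hT, rfl⟩
  have e1 : f (Φ fun x => Pi.single (y₀ x) 1) =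
      ∑ x, Finset.univ.sup' hJ (fun y => m y * p₁ x + b y * p₂ x) := by
    simp only [Φ, hf, Finset.mul_sum, ← Finset.sum_add_distrib]
    rw [Finset.sum_comm]
    refine Finset.sum_congr rfl fun x _ => ?_
    have : Finset.univ.sup' hJ (fun y => m y * p₁ x + b y * p₂ x) =
        m (y₀ x) * p₁ x + b (y₀ x) * p₂ x :=
      le_antisymm (Finset.sup'_le _ _ fun z _ => hy₀ x z)
        (Finset.le_sup' (fun y => m y * p₁ x + b y * p₂ x) (Finset.mem_univ (y₀ x)))
    rw [this, Finset.sum_eq_single (y₀ x)]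
    · simp
    · intro y _ hy
      simp [hy]
    · simp
  have e2 : f (q₁, q₂) ≤ ∑ y, Finset.univ.sup' hJ (fun z => m z * q₁ y + b z * q₂ y) := by
    rw [hf]
    exact Finset.sum_le_sum fun y _ =>
      Finset.le_sup' (fun z => m z * q₁ y + b z * q₂ y) (Finset.mem_univ y)
  have e3 := sum_sup'_hinge hp₂.1 hq₂.1 (hp₁.2.trans hq₁.2.symm) (hp₂.2.trans hq₂.2.symm) h' m b
    Finset.univ hJ
  linarith

lemma hinge_le_of_stoch {I J : Type} [Fintype I] [Fintype J]
    {p₁ p₂ : I → ℝ} {q₁ q₂ : J → ℝ} {T : J → I → ℝ} (hT : IsStoch T)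
    (h₁ : ∀ y, ∑ x, T y x * p₁ x = q₁ y) (h₂ : ∀ y, ∑ x, T y x * p₂ x = q₂ y) (t : ℝ) :
    ∑ y, max (q₁ y - t * q₂ y) 0 ≤ ∑ x, max (p₁ x - t * p₂ x) 0 := by
  calc ∑ y, max (q₁ y - t * q₂ y) 0
      ≤ ∑ y, ∑ x, T y x * max (p₁ x - t * p₂ x) 0 := by
        refine Finset.sum_le_sum fun y _ => max_le ?_
          (Finset.sum_nonneg fun x _ => mul_nonneg (hT.1 y x) (le_max_right _ _))
        rw [← h₁, ← h₂, Finset.mul_sum, ← Finset.sum_sub_distrib]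
        refine Finset.sum_le_sum fun x _ => ?_
        have := mul_le_mul_of_nonneg_left (le_max_left (p₁ x - t * p₂ x) 0) (hT.1 y x)
        linarith
    _ = ∑ x, max (p₁ x - t * p₂ x) 0 := by
        rw [Finset.sum_comm]
        refine Finset.sum_congr rfl fun x _ => ?_
        rw [← Finset.sum_mul, hT.2, one_mul]

lemma IsProb.kron {I J : Type} [Fintype I] [Fintype J] {p : I → ℝ} {q : J → ℝ}
    (hp : IsProb p) (hq : IsProb q) : IsProb (kron p q) := by
  refine ⟨fun x => mul_nonneg (hp.1 _) (hq.1 _), ?_⟩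
  simp only [_root_.kron, Fintype.sum_prod_type]
  rw [← Finset.sum_mul_sum, hp.2, hq.2, one_mul]

lemma IsProb.kpow {I : Type} [Fintype I] {p : I → ℝ} (hp : IsProb p) (n : ℕ) :
    IsProb (kpow p n) := by
  refine ⟨fun f => Finset.prod_nonneg fun j _ => hp.1 _, ?_⟩
  simp only [_root_.kpow]
  rw [← Fintype.sum_pow, hp.2, one_pow]

lemma IsProb.catVec {I J : Type} [Fintype I] [Fintype J] {p : I → ℝ} {q : J → ℝ}
    (hp : IsProb p) (hq : IsProb q) (n : ℕ) : IsProb (catVec n p q) := by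
  refine ⟨fun x => mul_nonneg (by positivity) (mul_nonneg
    (Finset.prod_nonneg fun j _ => hq.1 _) (Finset.prod_nonneg fun j _ => hp.1 _)), ?_⟩
  have h : ∀ a b : ℕ, ∑ g : Fin a → J, ∑ f : Fin b → I, (∏ j, q (g j)) * ∏ j, p (f j) = 1 := by
    intro a b
    rw [← Finset.sum_mul_sum, ← Fintype.sum_pow, ← Fintype.sum_pow, hp.2, hq.2]
    simp
  simp only [_root_.catVec, Fintype.sum_sigma, Fintype.sum_prod_type, ← Finset.mul_sum, h]
  simp
  field_simp

lemma IsDichotomy.catVec {I J : Type} [Fintype I] [Fintype J] {p₁ p₂ : I → ℝ} {q₁ q₂ : J → ℝ}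
    (hp : IsDichotomy p₁ p₂) (hq : IsDichotomy q₁ q₂) (n : ℕ) :
    IsDichotomy (catVec n p₁ q₁) (catVec n p₂ q₂) := by
  refine ⟨hp.1.catVec hq.1 n, hp.2.1.catVec hq.2.1 n, fun x hx => ?_⟩
  simp only [_root_.catVec, ne_eq, mul_eq_zero, Finset.prod_eq_zero_iff, Finset.mem_univ, true_and,
    not_or, not_exists] at hx ⊢
  exact ⟨hx.1, fun j => hq.2.2 _ (hx.2.1 j), fun j => hp.2.2 _ (hx.2.2 j)⟩

lemma IsDichotomy.kron {I J : Type} [Fintype I] [Fintype J] {p₁ p₂ : I → ℝ} {q₁ q₂ : J → ℝ}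
    (hp : IsDichotomy p₁ p₂) (hq : IsDichotomy q₁ q₂) :
    IsDichotomy (kron p₁ q₁) (kron p₂ q₂) :=
  ⟨hp.1.kron hq.1, hp.2.1.kron hq.2.1, fun _ hx =>
    mul_ne_zero (hp.2.2 _ (left_ne_zero_of_mul hx)) (hq.2.2 _ (right_ne_zero_of_mul hx))⟩

/-- Hinge sum of `q^{⊗a} ⊗ p^{⊗b}`. -/
def mixedHinge {I J : Type} [Fintype I] [Fintype J] (p₁ p₂ : I → ℝ) (q₁ q₂ : J → ℝ) (t : ℝ)
    (a b : ℕ) : ℝ :=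
  ∑ g : Fin a → J, ∑ f : Fin b → I,
    max ((∏ j, q₁ (g j)) * ∏ j, p₁ (f j) - t * ((∏ j, q₂ (g j)) * ∏ j, p₂ (f j))) 0

lemma sum_max_kron_catVec {I J L : Type} [Fintype I] [Fintype J] [Fintype L]
    (p₁ p₂ : I → ℝ) (q₁ q₂ : J → ℝ) (s₁ s₂ : L → ℝ) (n : ℕ) (t : ℝ) :
    ∑ x, max (kron (catVec n p₁ q₁) s₁ x - t * kron (catVec n p₂ q₂) s₂ x) 0 =
      (1 / (n + 1 : ℝ)) * ∑ ℓ : Fin (n + 1), ∑ g : Fin ℓ → J, ∑ f : Fin (n - ℓ) → I, ∑ x,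
        max ((∏ j, q₁ (g j)) * (∏ j, p₁ (f j)) * s₁ x -
          t * ((∏ j, q₂ (g j)) * (∏ j, p₂ (f j)) * s₂ x)) 0 := by
  simp only [kron, catVec, Fintype.sum_prod_type, Fintype.sum_sigma, Finset.mul_sum]
  have hn : (0 : ℝ) ≤ 1 / (n + 1 : ℝ) := by positivity
  refine Finset.sum_congr rfl fun ℓ _ => Finset.sum_congr rfl fun g _ =>
    Finset.sum_congr rfl fun f _ => Finset.sum_congr rfl fun x _ => ?_
  rw [mul_max_of_nonneg _ _ hn, mul_zero]
  ring_nf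

lemma hinge_catVec_le {I J : Type} [Fintype I] [Fintype J]
    (p₁ p₂ : I → ℝ) (q₁ q₂ : J → ℝ) (n : ℕ) (t : ℝ)
    (h : ∑ g, max (kpow q₁ (n + 1) g - t * kpow q₂ (n + 1) g) 0 ≤
      ∑ f, max (kpow p₁ (n + 1) f - t * kpow p₂ (n + 1) f) 0) :
    ∑ y, max (kron (catVec n p₁ q₁) q₁ y - t * kron (catVec n p₂ q₂) q₂ y) 0 ≤
      ∑ x, max (kron (catVec n p₁ q₁) p₁ x - t * kron (catVec n p₂ q₂) p₂ x) 0 := by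
  set G : ℕ → ℝ := fun k => mixedHinge p₁ p₂ q₁ q₂ t k (n + 1 - k) with hG
  have e1 : ∀ ℓ : Fin (n + 1), ∑ g : Fin ℓ → J, ∑ f : Fin (n - ℓ) → I, ∑ x,
        max ((∏ j, q₁ (g j)) * (∏ j, p₁ (f j)) * p₁ x -
          t * ((∏ j, q₂ (g j)) * (∏ j, p₂ (f j)) * p₂ x)) 0 = G ℓ := by
    intro ℓ
    have : n + 1 - (ℓ : ℕ) = (n - ℓ) + 1 := by have := ℓ.2; omega
    simp only [hG]
    rw [this, mixedHinge]
    refine Finset.sum_congr rfl fun g _ => ?_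
    rw [← (Fin.consEquiv fun _ => I).sum_comp, Fintype.sum_prod_type, Finset.sum_comm]
    refine Finset.sum_congr rfl fun x _ => Finset.sum_congr rfl fun f _ => ?_
    simp [Fin.consEquiv, Fin.prod_univ_succ]
    ring_nf
  have e2 : ∀ ℓ : Fin (n + 1), ∑ g : Fin ℓ → J, ∑ f : Fin (n - ℓ) → I, ∑ x,
        max ((∏ j, q₁ (g j)) * (∏ j, p₁ (f j)) * q₁ x -
          t * ((∏ j, q₂ (g j)) * (∏ j, p₂ (f j)) * q₂ x)) 0 = G (ℓ + 1) := by
    intro ℓ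
    have : n + 1 - ((ℓ : ℕ) + 1) = n - ℓ := by omega
    simp only [hG]
    rw [this, mixedHinge, ← (Fin.consEquiv fun _ => J).sum_comp, Fintype.sum_prod_type,
      Finset.sum_comm (s := (Finset.univ : Finset J))]
    refine Finset.sum_congr rfl fun g _ => ?_
    rw [Finset.sum_comm]
    refine Finset.sum_congr rfl fun x _ => Finset.sum_congr rfl fun f _ => ?_
    simp [Fin.consEquiv, Fin.prod_univ_succ]
    ring_nf
  have h0 : G 0 = ∑ f, max (kpow p₁ (n + 1) f - t * kpow p₂ (n + 1) f) 0 := by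
    simp [hG, mixedHinge, kpow]
  have hn : G (n + 1) = ∑ f, max (kpow q₁ (n + 1) f - t * kpow q₂ (n + 1) f) 0 := by
    simp only [hG]
    rw [Nat.sub_self, mixedHinge]
    simp [kpow]
  rw [sum_max_kron_catVec, sum_max_kron_catVec]
  refine mul_le_mul_of_nonneg_left ?_ (by positivity)
  rw [Finset.sum_congr rfl fun ℓ _ => e1 ℓ, Finset.sum_congr rfl fun ℓ _ => e2 ℓ,
    Fin.sum_univ_eq_sum_range G, Fin.sum_univ_eq_sum_range fun k => G (k + 1)]
  have := Finset.sum_range_sub' G (n + 1)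
  rw [Finset.sum_sub_distrib] at this
  linarith

/-- Partition function `∑ c e^{αl}` of a weighted family of log-likelihoods. -/
def partFn {I : Type} [Fintype I] (c l : I → ℝ) (α : ℝ) : ℝ := ∑ x, c x * Real.exp (α * l x)

/-- Derivative of the partition function. -/
def partFn' {I : Type} [Fintype I] (c l : I → ℝ) (α : ℝ) : ℝ :=
  ∑ x, c x * (l x * Real.exp (α * l x))

/-- Weight of a sequence. -/
def seqWt {I : Type} {n : ℕ} (c : I → ℝ) (f : Fin n → I) : ℝ := ∏ j, c (f j)

/-- Total log-likelihood of a sequence. -/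
def seqSum {I : Type} {n : ℕ} (l : I → ℝ) (f : Fin n → I) : ℝ := ∑ j, l (f j)

/-- Hinge sum of the `n`-th power at threshold `t`. -/
def hingeSum {I : Type} [Fintype I] (c l : I → ℝ) (n : ℕ) (t : ℝ) : ℝ :=
  ∑ f : Fin n → I, seqWt c f * max (Real.exp (seqSum l f) - t) 0

/-- Truncated sum of the `n`-th power at threshold `t`. -/
def truncSum {I : Type} [Fintype I] (c l : I → ℝ) (n : ℕ) (t : ℝ) : ℝ :=
  ∑ f : Fin n → I, seqWt c f * min (Real.exp (seqSum l f)) t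

lemma seqWt_nonneg {I : Type} {c : I → ℝ} (hc : ∀ x, 0 ≤ c x) {n : ℕ} (f : Fin n → I) :
    0 ≤ seqWt c f :=
  Finset.prod_nonneg fun _ _ => hc _

lemma eventually_lt_right_of_deriv_neg {h : ℝ → ℝ} {h' x : ℝ} (hd : HasDerivAt h h' x)
    (hh : h' < 0) : ∀ᶠ y in nhdsWithin x (Set.Ioi x), h y < h x := by
  have := ((hasDerivAt_iff_tendsto_slope.1 hd).mono_left
    (nhdsWithin_mono x fun y (hy : x < y) => hy.ne')).eventually (gt_mem_nhds hh)
  filter_upwards [this, self_mem_nhdsWithin] with y hy hxy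
  have hxy' : x < y := hxy
  rw [slope_def_field, div_lt_iff₀ (by linarith)] at hy
  linarith

lemma eventually_lt_left_of_deriv_pos {h : ℝ → ℝ} {h' x : ℝ} (hd : HasDerivAt h h' x)
    (hh : 0 < h') : ∀ᶠ y in nhdsWithin x (Set.Iio x), h y < h x := by
  have := ((hasDerivAt_iff_tendsto_slope.1 hd).mono_left
    (nhdsWithin_mono x fun y (hy : y < x) => hy.ne)).eventually (lt_mem_nhds hh)
  filter_upwards [this, self_mem_nhdsWithin] with y hy hxy
  have hxy' : y < x := hxy
  rw [slope_def_field, lt_div_iff_of_neg (by linarith)] at hy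
  linarith

section Asymptotics

variable {I J : Type} [Fintype I] [Fintype J] {c l : I → ℝ} {d k : J → ℝ}

lemma sum_seqWt_mul_exp (c l : I → ℝ) (n : ℕ) (α : ℝ) :
    ∑ f : Fin n → I, seqWt c f * Real.exp (α * seqSum l f) = partFn c l α ^ n := by
  rw [partFn, Fintype.sum_pow]
  refine Finset.sum_congr rfl fun f _ => ?_
  rw [seqWt, seqSum, Finset.mul_sum, Real.exp_sum, Finset.prod_mul_distrib]

lemma hingeSum_add_truncSum (h1 : partFn c l 1 = 1) (n : ℕ) (t : ℝ) :
    hingeSum c l n t + truncSum c l n t = 1 := by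
  have := sum_seqWt_mul_exp c l n 1
  rw [h1, one_pow] at this
  rw [← this, hingeSum, truncSum, ← Finset.sum_add_distrib]
  refine Finset.sum_congr rfl fun f _ => ?_
  rw [← mul_add, one_mul]
  congr 1
  rcases le_total (Real.exp (seqSum l f)) t with h | h
  · rw [min_eq_left h, max_eq_right (by linarith)]; ring
  · rw [min_eq_right h, max_eq_left (by linarith)]; ring

lemma hasDerivAt_partFn (c l : I → ℝ) (α : ℝ) :
    HasDerivAt (partFn c l) (partFn' c l α) α := by
  unfold partFn partFn'
  refine HasDerivAt.fun_sum fun x _ => ?_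
  have : HasDerivAt (fun α : ℝ => α * l x) (l x) α := by simpa using (hasDerivAt_id α).mul_const (l x)
  simpa [mul_comm (l x)] using this.exp.const_mul (c x)

lemma continuous_partFn (c l : I → ℝ) : Continuous (partFn c l) := by
  unfold partFn; fun_prop

lemma continuous_partFn' (c l : I → ℝ) : Continuous (partFn' c l) := by
  unfold partFn'; fun_prop

lemma partFn_pos (hc : ∀ x, 0 ≤ c x) {α : ℝ} (h : 0 < partFn c l α) (β : ℝ) :
    0 < partFn c l β := by
  obtain ⟨x, -, hx⟩ := Finset.exists_lt_of_sum_lt (s := Finset.univ) (f := fun _ => (0 : ℝ))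
    (g := fun x => c x * Real.exp (α * l x)) (by simpa [partFn] using h)
  have hx' : 0 < c x := pos_of_mul_pos_left hx (Real.exp_pos _).le
  exact Finset.sum_pos' (fun y _ => mul_nonneg (hc y) (Real.exp_pos _).le)
    ⟨x, Finset.mem_univ _, mul_pos hx' (Real.exp_pos _)⟩

/-- Exponential Markov bound in base form. -/
lemma eventually_partFn_lt_one (h1 : partFn c l 0 = 1) (h : partFn' c l 0 < 0) :
    ∃ s : ℝ, 0 < s ∧ partFn c l s < 1 := by
  obtain ⟨s, hs, hs0⟩ := ((eventually_lt_right_of_deriv_neg (hasDerivAt_partFn c l 0) h).and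
    self_mem_nhdsWithin).exists
  exact ⟨s, hs0, h1 ▸ hs⟩

lemma eventually_sum_tail_lt (hc : ∀ x, 0 ≤ c x) (h1 : partFn c l 0 = 1) {a : ℝ}
    (h : partFn' c l 0 < a) :
    ∀ᶠ n : ℕ in Filter.atTop,
      ∑ f : Fin n → I, seqWt c f * (if n * a < seqSum l f then 1 else 0) < 1 / 4 := by
  have hs0 : ∑ x, c x = 1 := by simpa [partFn] using h1
  have e1 : partFn c (fun x => l x - a) 0 = 1 := by simpa [partFn] using h1
  have e2 : partFn' c (fun x => l x - a) 0 < 0 := by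
    have : partFn' c (fun x => l x - a) 0 = partFn' c l 0 - a := by
      simp only [partFn', zero_mul, Real.exp_zero, mul_one]
      simp only [mul_sub, Finset.sum_sub_distrib, ← Finset.sum_mul, hs0, one_mul]
    linarith
  obtain ⟨s, hs, hlt⟩ := eventually_partFn_lt_one e1 e2
  have hnn : 0 ≤ partFn c (fun x => l x - a) s :=
    Finset.sum_nonneg fun x _ => mul_nonneg (hc x) (Real.exp_pos _).le
  have ht := tendsto_pow_atTop_nhds_zero_of_lt_one hnn hlt
  filter_upwards [ht.eventually (gt_mem_nhds (by norm_num : (0 : ℝ) < 1 / 4))] with n hn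
  refine lt_of_le_of_lt ?_ hn
  rw [← sum_seqWt_mul_exp]
  refine Finset.sum_le_sum fun f _ => mul_le_mul_of_nonneg_left ?_ (seqWt_nonneg hc f)
  split_ifs with hf
  · rw [Real.one_le_exp_iff]
    have : seqSum (fun x => l x - a) f = seqSum l f - n * a := by
      simp [seqSum, Finset.sum_sub_distrib]
    rw [this]
    exact mul_nonneg hs.le (by linarith)
  · positivity

/-- The tilted mass concentrates around the tilted mean. -/
lemma eventually_tilted_mass (hc : ∀ x, 0 ≤ c x) {α : ℝ} (hZ : 0 < partFn c l α) {ε : ℝ}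
    (hε : 0 < ε) :
    ∀ᶠ n : ℕ in Filter.atTop, partFn c l α ^ n / 2 ≤
      ∑ f : Fin n → I, seqWt c f * Real.exp (α * seqSum l f) *
        (if |seqSum l f - n * (partFn' c l α / partFn c l α)| ≤ n * ε then 1 else 0) := by
  set Z := partFn c l α with hZdef
  set μ := partFn' c l α / Z with hμ
  set w : I → ℝ := fun x => c x * Real.exp (α * l x) / Z with hw
  have hw0 : ∀ x, 0 ≤ w x := fun x => div_nonneg (mul_nonneg (hc x) (Real.exp_pos _).le) hZ.le
  have hwsum : ∑ x, w x = 1 := by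
    rw [hw, ← Finset.sum_div, ← partFn, ← hZdef, div_self hZ.ne']
  have hw1 : ∀ m : I → ℝ, partFn w m 0 = 1 := fun m => by simpa [partFn] using hwsum
  have hwμ : partFn' w l 0 = μ := by
    simp only [partFn', zero_mul, Real.exp_zero, mul_one, hμ, hw, Finset.sum_div]
    exact Finset.sum_congr rfl fun x _ => by ring
  have hwμ' : partFn' w (fun x => - l x) 0 = -μ := by
    rw [← hwμ]; simp [partFn']
  have t1 := eventually_sum_tail_lt (l := l) hw0 (hw1 _) (a := μ + ε) (by rw [hwμ]; linarith)
  have t2 := eventually_sum_tail_lt (l := fun x => - l x) hw0 (hw1 _) (a := -μ + ε)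
    (by rw [hwμ']; linarith)
  filter_upwards [t1, t2] with n h1 h2
  have hwt : ∀ f : Fin n → I, seqWt c f * Real.exp (α * seqSum l f) = Z ^ n * seqWt w f := by
    intro f
    simp only [seqWt, seqSum, hw, Finset.prod_div_distrib, Finset.prod_mul_distrib,
      Finset.mul_sum, Real.exp_sum, Finset.prod_const, Finset.card_univ, Fintype.card_fin]
    field_simp
  have hneg : ∀ f : Fin n → I, seqSum (fun x => - l x) f = - seqSum l f := fun f => by
    simp [seqSum]
  have htot : ∑ f : Fin n → I, seqWt w f = 1 := by
    simp only [seqWt]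
    rw [← Fintype.sum_pow, hwsum, one_pow]
  have key : 1 ≤ ∑ f : Fin n → I, seqWt w f *
        (if |seqSum l f - n * μ| ≤ n * ε then 1 else 0) +
      ∑ f : Fin n → I, seqWt w f * (if n * (μ + ε) < seqSum l f then 1 else 0) +
      ∑ f : Fin n → I, seqWt w f * (if n * (-μ + ε) < seqSum (fun x => - l x) f then 1 else 0) := by
    refine htot.symm.le.trans ?_
    rw [← Finset.sum_add_distrib, ← Finset.sum_add_distrib]
    refine Finset.sum_le_sum fun f _ => ?_
    rw [← mul_add, ← mul_add]
    refine le_mul_of_one_le_right (seqWt_nonneg hw0 f) ?_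
    rw [hneg]
    by_cases hf : |seqSum l f - n * μ| ≤ n * ε
    · rw [if_pos hf]
      have : ∀ P : Prop, (0 : ℝ) ≤ if P then 1 else 0 := fun P => by split_ifs <;> norm_num
      linarith [this (n * (μ + ε) < seqSum l f), this (n * (-μ + ε) < - seqSum l f)]
    · rw [if_neg hf]
      rw [not_le, lt_abs] at hf
      rcases hf with hf | hf
      · rw [if_pos (by linarith)]
        split_ifs <;> norm_num
      · rw [if_pos (show n * (-μ + ε) < - seqSum l f by linarith)]
        split_ifs <;> norm_num
  simp only [hwt, mul_assoc, ← Finset.mul_sum]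
  rw [div_eq_mul_one_div]
  exact mul_le_mul_of_nonneg_left (by linarith) (pow_nonneg hZ.le n)

lemma hingeSum_le (hc : ∀ x, 0 ≤ c x) {β : ℝ} (hβ : 1 ≤ β) (n : ℕ) (a : ℝ) :
    hingeSum c l n (Real.exp (n * a)) ≤ partFn c l β ^ n * Real.exp (n * ((1 - β) * a)) := by
  rw [← sum_seqWt_mul_exp, Finset.sum_mul, hingeSum]
  refine Finset.sum_le_sum fun f _ => ?_
  rw [mul_assoc]
  refine mul_le_mul_of_nonneg_left (max_le ?_ (by positivity)) (seqWt_nonneg hc f)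
  rw [← Real.exp_add]
  rcases le_total (seqSum l f) (n * a) with h | h
  · have := Real.exp_le_exp.2 h
    have := Real.exp_pos (β * seqSum l f + n * ((1 - β) * a))
    linarith
  · have : Real.exp (seqSum l f) ≤ Real.exp (β * seqSum l f + n * ((1 - β) * a)) :=
      Real.exp_le_exp.2 (by nlinarith)
    linarith [Real.exp_pos (n * a)]

lemma truncSum_le (hc : ∀ x, 0 ≤ c x) {β : ℝ} (h0 : 0 ≤ β) (h1 : β ≤ 1) (n : ℕ) (a : ℝ) :
    truncSum c l n (Real.exp (n * a)) ≤ partFn c l β ^ n * Real.exp (n * ((1 - β) * a)) := by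
  rw [← sum_seqWt_mul_exp, Finset.sum_mul, truncSum]
  refine Finset.sum_le_sum fun f _ => ?_
  rw [mul_assoc, ← Real.exp_add]
  refine mul_le_mul_of_nonneg_left ?_ (seqWt_nonneg hc f)
  rcases le_total (seqSum l f) (n * a) with h | h
  · exact (min_le_left _ _).trans (Real.exp_le_exp.2 (by nlinarith))
  · exact (min_le_right _ _).trans (Real.exp_le_exp.2 (by nlinarith))

lemma eventually_le_hingeSum (hc : ∀ x, 0 ≤ c x) {α : ℝ} (hZ : 0 < partFn c l α) {ε : ℝ}
    (hε : 0 < ε) :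
    ∀ᶠ n : ℕ in Filter.atTop, ∀ a, a ≤ partFn' c l α / partFn c l α - 2 * ε →
      partFn c l α ^ n / 4 *
        Real.exp (n * ((1 - α) * (partFn' c l α / partFn c l α) - |1 - α| * ε)) ≤
      hingeSum c l n (Real.exp (n * a)) := by
  have hev : ∀ᶠ n : ℕ in Filter.atTop, 1 ≤ (n : ℝ) * ε :=
    (tendsto_natCast_atTop_atTop.atTop_mul_const hε).eventually_ge_atTop 1
  filter_upwards [eventually_tilted_mass hc hZ hε, hev] with n hn hnε a ha
  set μ := partFn' c l α / partFn c l α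
  have hn0 : (0 : ℝ) ≤ n := Nat.cast_nonneg n
  calc _ = partFn c l α ^ n / 2 * (1 / 2 * Real.exp (n * ((1 - α) * μ - |1 - α| * ε))) := by ring
    _ ≤ _ := mul_le_mul_of_nonneg_right hn (by positivity)
    _ ≤ _ := by
      rw [Finset.sum_mul, hingeSum]
      refine Finset.sum_le_sum fun f _ => ?_
      rw [mul_assoc, mul_assoc]
      refine mul_le_mul_of_nonneg_left ?_ (seqWt_nonneg hc f)
      split_ifs with hf
      · refine le_trans ?_ (le_max_left _ _)
        have hlow := abs_le.1 hf
        have h1 : (1 - α) * (n * μ) - |1 - α| * (n * ε) ≤ (1 - α) * seqSum l f := by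
          have := neg_abs_le ((1 - α) * (seqSum l f - n * μ))
          rw [abs_mul] at this
          nlinarith [mul_le_mul_of_nonneg_left hf (abs_nonneg (1 - α))]
        have h2 : Real.exp (α * seqSum l f) *
            Real.exp (n * ((1 - α) * μ - |1 - α| * ε)) ≤ Real.exp (seqSum l f) := by
          rw [← Real.exp_add]
          exact Real.exp_le_exp.2 (by nlinarith)
        have h3 : Real.exp (n * a) * 2 ≤ Real.exp (seqSum l f) := by
          have e : Real.exp (n * a) * Real.exp 1 ≤ Real.exp (seqSum l f) := by
            rw [← Real.exp_add]
            exact Real.exp_le_exp.2 (by nlinarith [mul_le_mul_of_nonneg_left ha hn0])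
          have := Real.add_one_le_exp (1 : ℝ)
          nlinarith [Real.exp_pos (n * a)]
        linarith
      · simp

lemma eventually_le_truncSum (hc : ∀ x, 0 ≤ c x) {α : ℝ} (hZ : 0 < partFn c l α) {ε : ℝ}
    (hε : 0 < ε) :
    ∀ᶠ n : ℕ in Filter.atTop, ∀ a, partFn' c l α / partFn c l α - ε ≤ a →
      partFn c l α ^ n / 2 *
        Real.exp (n * ((1 - α) * (partFn' c l α / partFn c l α) - (|1 - α| + 2) * ε)) ≤
      truncSum c l n (Real.exp (n * a)) := by
  filter_upwards [eventually_tilted_mass hc hZ hε] with n hn a ha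
  set μ := partFn' c l α / partFn c l α
  have hn0 : (0 : ℝ) ≤ n := Nat.cast_nonneg n
  refine (mul_le_mul_of_nonneg_right hn (Real.exp_pos _).le).trans ?_
  rw [Finset.sum_mul, truncSum]
  refine Finset.sum_le_sum fun f _ => ?_
  rw [mul_assoc, mul_assoc]
  refine mul_le_mul_of_nonneg_left ?_ (seqWt_nonneg hc f)
  split_ifs with hf
  · have hlow := abs_le.1 hf
    have hnε : 0 ≤ n * ε := by positivity
    have hna := mul_le_mul_of_nonneg_left ha hn0
    have h1 : (1 - α) * (n * μ) - |1 - α| * (n * ε) ≤ (1 - α) * seqSum l f := by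
      have := neg_abs_le ((1 - α) * (seqSum l f - n * μ))
      rw [abs_mul] at this
      nlinarith [mul_le_mul_of_nonneg_left hf (abs_nonneg (1 - α))]
    rw [one_mul, ← Real.exp_add]
    refine le_min (Real.exp_le_exp.2 ?_) (Real.exp_le_exp.2 ?_) <;> nlinarith
  · simp only [zero_mul, mul_zero]; positivity

lemma eventually_le_truncSum_of_le (hc : ∀ x, 0 ≤ c x) (hZ : 0 < partFn c l 0) {ε : ℝ}
    (hε : 0 < ε) :
    ∀ᶠ n : ℕ in Filter.atTop, ∀ a, a ≤ partFn' c l 0 / partFn c l 0 + ε →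
      partFn c l 0 ^ n / 2 * Real.exp (n * (a - 2 * ε)) ≤ truncSum c l n (Real.exp (n * a)) := by
  filter_upwards [eventually_tilted_mass hc hZ hε] with n hn a ha
  set μ := partFn' c l 0 / partFn c l 0
  have hn0 : (0 : ℝ) ≤ n := Nat.cast_nonneg n
  refine (mul_le_mul_of_nonneg_right hn (Real.exp_pos _).le).trans ?_
  rw [Finset.sum_mul, truncSum]
  refine Finset.sum_le_sum fun f _ => ?_
  rw [mul_assoc, mul_assoc]
  refine mul_le_mul_of_nonneg_left ?_ (seqWt_nonneg hc f)
  split_ifs with hf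
  · have hlow := abs_le.1 hf
    have hnε : 0 ≤ n * ε := by positivity
    have hna := mul_le_mul_of_nonneg_left ha hn0
    rw [one_mul, ← Real.exp_add]
    refine le_min (Real.exp_le_exp.2 ?_) (Real.exp_le_exp.2 ?_) <;> nlinarith
  · simp only [zero_mul, mul_zero]; positivity

lemma eventually_mul_exp_le {A B : ℝ} (h : A < B) (K : ℝ) :
    ∀ᶠ n : ℕ in Filter.atTop, K * Real.exp (n * A) ≤ Real.exp (n * B) := by
  have ht : Filter.Tendsto (fun n : ℕ => Real.exp (n * (B - A))) Filter.atTop Filter.atTop :=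
    Real.tendsto_exp_atTop.comp
      (tendsto_natCast_atTop_atTop.atTop_mul_const (sub_pos.2 h))
  filter_upwards [ht.eventually_ge_atTop K] with n hn
  calc K * Real.exp (n * A) ≤ Real.exp (n * (B - A)) * Real.exp (n * A) := by gcongr
    _ = Real.exp (n * B) := by rw [← Real.exp_add]; ring_nf

lemma pow_eq_exp_mul_log {z : ℝ} (hz : 0 < z) (n : ℕ) : z ^ n = Real.exp (n * Real.log z) := by
  rw [mul_comm, Real.exp_mul, Real.exp_log hz, Real.rpow_natCast]

lemma hingeSum_le_hingeSum_iff (c1 : partFn c l 1 = 1) (d1 : partFn d k 1 = 1) (n : ℕ) (t : ℝ) :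
    hingeSum d k n t ≤ hingeSum c l n t ↔ truncSum c l n t ≤ truncSum d k n t := by
  have h1 := hingeSum_add_truncSum c1 n t
  have h2 := hingeSum_add_truncSum d1 n t
  constructor <;> intro h <;> linarith

lemma exists_eps (g m : ℝ) (hg : 0 < g) (hm : 0 ≤ m) : ∃ ε : ℝ, 0 < ε ∧ m * ε < g := by
  refine ⟨g / (m + 1), by positivity, ?_⟩
  rw [← mul_div_assoc, div_lt_iff₀ (by positivity)]
  nlinarith

lemma local_hinge_upper (hc : ∀ x, 0 ≤ c x) (hd : ∀ x, 0 ≤ d x) (c1 : partFn c l 1 = 1)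
    (d1 : partFn d k 1 = 1) {α β a₀ : ℝ} (hβ : 1 ≤ β)
    (hα : a₀ < partFn' c l α / partFn c l α)
    (h : Real.log (partFn d k β) + (1 - β) * a₀ <
      Real.log (partFn c l α) + (1 - α) * (partFn' c l α / partFn c l α)) :
    ∃ ε > 0, ∀ᶠ n : ℕ in Filter.atTop, ∀ a, |a - a₀| < ε →
      hingeSum d k n (Real.exp (n * a)) ≤ hingeSum c l n (Real.exp (n * a)) := by
  have hZc : 0 < partFn c l α := partFn_pos hc (c1 ▸ one_pos) α
  have hZd : 0 < partFn d k β := partFn_pos hd (d1 ▸ one_pos) β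
  set μ := partFn' c l α / partFn c l α
  obtain ⟨ε₁, hε₁, h1⟩ := exists_eps (μ - a₀) 3 (by linarith) (by norm_num)
  obtain ⟨ε₂, hε₂, h2⟩ := exists_eps _ (|1 - α| + |1 - β|) (sub_pos.2 h) (by positivity)
  set ε := min ε₁ ε₂
  have hε : 0 < ε := lt_min hε₁ hε₂
  have h1' : 3 * ε < μ - a₀ := by have := min_le_left ε₁ ε₂; linarith
  have h2' : (|1 - α| + |1 - β|) * ε ≤ (|1 - α| + |1 - β|) * ε₂ :=
    mul_le_mul_of_nonneg_left (min_le_right _ _) (by positivity)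
  refine ⟨ε, hε, ?_⟩
  have hAB : Real.log (partFn d k β) + (1 - β) * a₀ + |1 - β| * ε <
      Real.log (partFn c l α) + ((1 - α) * μ - |1 - α| * ε) := by linarith
  filter_upwards [eventually_le_hingeSum hc hZc hε, eventually_mul_exp_le hAB 4] with n hn he a ha
  refine (hingeSum_le hd hβ n a).trans (le_trans ?_ (hn a (by linarith [(abs_lt.1 ha).2])))
  rw [pow_eq_exp_mul_log hZd, pow_eq_exp_mul_log hZc, ← Real.exp_add, div_mul_eq_mul_div,
    ← Real.exp_add, ← mul_add, ← mul_add, le_div_iff₀ (by norm_num), mul_comm]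
  refine le_trans (mul_le_mul_of_nonneg_left (Real.exp_le_exp.2
    (mul_le_mul_of_nonneg_left ?_ n.cast_nonneg)) (by norm_num)) he
  have := le_abs_self ((1 - β) * (a - a₀))
  rw [abs_mul] at this
  nlinarith [mul_le_mul_of_nonneg_left ha.le (abs_nonneg (1 - β))]

lemma local_hinge_lower (hc : ∀ x, 0 ≤ c x) (hd : ∀ x, 0 ≤ d x) (c1 : partFn c l 1 = 1)
    (d1 : partFn d k 1 = 1) {α β a₀ : ℝ} (hβ0 : 0 ≤ β) (hβ : β ≤ 1)
    (hα : partFn' d k α / partFn d k α ≤ a₀)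
    (h : Real.log (partFn c l β) + (1 - β) * a₀ <
      Real.log (partFn d k α) + (1 - α) * (partFn' d k α / partFn d k α)) :
    ∃ ε > 0, ∀ᶠ n : ℕ in Filter.atTop, ∀ a, |a - a₀| < ε →
      hingeSum d k n (Real.exp (n * a)) ≤ hingeSum c l n (Real.exp (n * a)) := by
  have hZc : 0 < partFn c l β := partFn_pos hc (c1 ▸ one_pos) β
  have hZd : 0 < partFn d k α := partFn_pos hd (d1 ▸ one_pos) α
  set μ := partFn' d k α / partFn d k α
  obtain ⟨ε, hε, h2⟩ := exists_eps _ (|1 - α| + 2 + |1 - β|) (sub_pos.2 h) (by positivity)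
  refine ⟨ε, hε, ?_⟩
  have hAB : Real.log (partFn c l β) + (1 - β) * a₀ + |1 - β| * ε <
      Real.log (partFn d k α) + ((1 - α) * μ - (|1 - α| + 2) * ε) := by linarith
  filter_upwards [eventually_le_truncSum hd hZd hε, eventually_mul_exp_le hAB 2] with n hn he a ha
  rw [hingeSum_le_hingeSum_iff c1 d1]
  refine (truncSum_le hc hβ0 hβ n a).trans (le_trans ?_ (hn a (by linarith [(abs_lt.1 ha).1])))
  rw [pow_eq_exp_mul_log hZd, pow_eq_exp_mul_log hZc, ← Real.exp_add, div_mul_eq_mul_div,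
    ← Real.exp_add, ← mul_add, ← mul_add, le_div_iff₀ (by norm_num), mul_comm]
  refine le_trans (mul_le_mul_of_nonneg_left (Real.exp_le_exp.2
    (mul_le_mul_of_nonneg_left ?_ n.cast_nonneg)) (by norm_num)) he
  have := le_abs_self ((1 - β) * (a - a₀))
  rw [abs_mul] at this
  nlinarith [mul_le_mul_of_nonneg_left ha.le (abs_nonneg (1 - β))]

lemma left_tail_hinge (hc : ∀ x, 0 ≤ c x) (hd : ∀ x, 0 ≤ d x) (c1 : partFn c l 1 = 1)
    (d1 : partFn d k 1 = 1) (h : partFn c l 0 < partFn d k 0) :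
    ∃ ε > 0, ∀ᶠ n : ℕ in Filter.atTop, ∀ a, a ≤ partFn' d k 0 / partFn d k 0 + ε →
      hingeSum d k n (Real.exp (n * a)) ≤ hingeSum c l n (Real.exp (n * a)) := by
  have hZc : 0 < partFn c l 0 := partFn_pos hc (c1 ▸ one_pos) 0
  have hZd : 0 < partFn d k 0 := partFn_pos hd (d1 ▸ one_pos) 0
  obtain ⟨ε, hε, h2⟩ := exists_eps _ 2 (sub_pos.2 (Real.log_lt_log hZc h)) (by norm_num)
  refine ⟨ε, hε, ?_⟩
  have hAB : Real.log (partFn c l 0) < Real.log (partFn d k 0) - 2 * ε := by linarith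
  filter_upwards [eventually_le_truncSum_of_le hd hZd hε, eventually_mul_exp_le hAB 2]
    with n hn he a ha
  rw [hingeSum_le_hingeSum_iff c1 d1]
  refine (truncSum_le hc le_rfl zero_le_one n a).trans (le_trans ?_ (hn a ha))
  have e : Real.exp (n * (a - 2 * ε)) = Real.exp (n * a) * Real.exp (n * (-(2 * ε))) := by
    rw [← Real.exp_add]; ring_nf
  have e' : Real.exp (n * (Real.log (partFn d k 0) - 2 * ε)) =
      partFn d k 0 ^ n * Real.exp (n * (-(2 * ε))) := by
    rw [pow_eq_exp_mul_log hZd, ← Real.exp_add]; ring_nf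
  rw [e', ← pow_eq_exp_mul_log hZc] at he
  rw [e, sub_zero, one_mul]
  nlinarith [Real.exp_pos (n * a)]

lemma hasDerivAt_log_partFn (c1 : partFn c l 1 = 1) (a : ℝ) :
    HasDerivAt (fun β => Real.log (partFn c l β) + (1 - β) * a) (partFn' c l 1 - a) 1 := by
  have h1 := (hasDerivAt_partFn c l 1).log (by rw [c1]; norm_num)
  have h2 : HasDerivAt (fun β : ℝ => (1 - β) * a) (-a) 1 := by
    simpa using ((hasDerivAt_id (1 : ℝ)).const_sub 1).mul_const a
  rw [c1, div_one] at h1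
  exact h1.add h2

lemma exists_tilted_mean_gt (hc : ∀ x, 0 ≤ c x) (c1 : partFn c l 1 = 1) {x₀ : I}
    (hx₀ : 0 < c x₀) {a : ℝ} (ha : a < l x₀) :
    ∃ K : ℝ, 1 ≤ K ∧ a < partFn' c l K / partFn c l K := by
  have hb : 0 < l x₀ - a := sub_pos.2 ha
  have ht : Filter.Tendsto (fun K : ℝ => c x₀ * (l x₀ - a) * Real.exp (K * (l x₀ - a)))
      Filter.atTop Filter.atTop :=
    (Real.tendsto_exp_atTop.comp (Filter.tendsto_id.atTop_mul_const hb)).const_mul_atTop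
      (mul_pos hx₀ hb)
  obtain ⟨K, hK, hK1⟩ := ((ht.eventually_gt_atTop (∑ x, c x * |l x - a|)).and
    (Filter.eventually_ge_atTop 1)).exists
  refine ⟨K, hK1, ?_⟩
  rw [lt_div_iff₀ (partFn_pos hc (c1 ▸ one_pos) K)]
  have hlow : ∀ x, -(c x * |l x - a|) ≤ c x * (l x - a) * Real.exp (K * (l x - a)) := by
    intro x
    have hcx := hc x
    rcases le_total (l x) a with h | h
    · have e1 : Real.exp (K * (l x - a)) ≤ 1 :=
        Real.exp_le_one_iff.2 (mul_nonpos_of_nonneg_of_nonpos (by linarith) (by linarith))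
      rw [abs_of_nonpos (by linarith)]
      nlinarith [mul_nonneg hcx (sub_nonneg.2 h),
        mul_nonneg (mul_nonneg hcx (sub_nonneg.2 h)) (sub_nonneg.2 e1)]
    · have : 0 ≤ c x * (l x - a) * Real.exp (K * (l x - a)) :=
        mul_nonneg (mul_nonneg hcx (by linarith)) (Real.exp_pos _).le
      linarith [mul_nonneg hcx (abs_nonneg (l x - a))]
  have hpos : 0 < ∑ x, c x * (l x - a) * Real.exp (K * (l x - a)) := by
    rw [← Finset.add_sum_erase _ _ (Finset.mem_univ x₀)]
    have h1 : -∑ x ∈ Finset.univ.erase x₀, c x * |l x - a| ≤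
        ∑ x ∈ Finset.univ.erase x₀, c x * (l x - a) * Real.exp (K * (l x - a)) := by
      rw [← Finset.sum_neg_distrib]
      exact Finset.sum_le_sum fun x _ => hlow x
    have h2 : ∑ x ∈ Finset.univ.erase x₀, c x * |l x - a| ≤ ∑ x, c x * |l x - a| :=
      Finset.sum_le_sum_of_subset_of_nonneg (Finset.erase_subset _ _)
        fun x _ _ => mul_nonneg (hc x) (abs_nonneg _)
    linarith
  have hexp : ∑ x, c x * (l x - a) * Real.exp (K * (l x - a)) =
      Real.exp (-(K * a)) * (partFn' c l K - a * partFn c l K) := by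
    simp only [partFn, partFn', Finset.mul_sum, ← Finset.sum_sub_distrib]
    refine Finset.sum_congr rfl fun x _ => ?_
    rw [mul_sub K, sub_eq_add_neg (K * l x), Real.exp_add]
    ring
  rw [hexp] at hpos
  have := pos_of_mul_pos_right hpos (Real.exp_pos _).le
  linarith

/-- Strict comparison of all Rényi-type quantities gives, for large powers, comparison of all
hinge sums. -/
lemma eventually_hingeSum_le (hc : ∀ x, 0 ≤ c x) (hd : ∀ x, 0 ≤ d x) (c1 : partFn c l 1 = 1)
    (d1 : partFn d k 1 = 1)
    (hlt : ∀ α, 0 ≤ α → α < 1 → partFn c l α < partFn d k α)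
    (hgt : ∀ α, 1 < α → partFn d k α < partFn c l α)
    (hder : partFn' d k 1 < partFn' c l 1)
    (hmax : ∃ x, 0 < c x ∧ ∀ y, 0 < d y → k y < l x) :
    ∃ N : ℕ, ∀ n ≥ N, ∀ t : ℝ, 0 ≤ t → hingeSum d k n t ≤ hingeSum c l n t := by
  have hZc : ∀ α, 0 < partFn c l α := partFn_pos hc (c1 ▸ one_pos)
  have hZd : ∀ α, 0 < partFn d k α := partFn_pos hd (d1 ▸ one_pos)
  have hμc : Continuous fun α => partFn' c l α / partFn c l α :=
    (continuous_partFn' c l).div (continuous_partFn c l) fun α => (hZc α).ne'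
  have hμd : Continuous fun α => partFn' d k α / partFn d k α :=
    (continuous_partFn' d k).div (continuous_partFn d k) fun α => (hZd α).ne'
  obtain ⟨x₀, hx₀, hx₀'⟩ := hmax
  have hdne : (Finset.univ.filter fun y => 0 < d y).Nonempty := by
    by_contra hne
    have hz : ∀ y, d y = 0 := fun y => le_antisymm
      (not_lt.1 fun h => hne ⟨y, by simp [h]⟩) (hd y)
    simp [partFn, hz] at d1
  obtain ⟨y₀, hy₀, hy₀'⟩ := Finset.exists_max_image _ k hdne
  simp only [Finset.mem_filter, Finset.mem_univ, true_and] at hy₀ hy₀'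
  obtain ⟨ε, hε, hleft⟩ := left_tail_hinge hc hd c1 d1 (hlt 0 le_rfl zero_lt_one)
  have hlocal : ∀ a₀ ∈ Set.Icc (partFn' d k 0 / partFn d k 0 + ε) (k y₀),
      ∃ ε > 0, ∀ᶠ n : ℕ in Filter.atTop, ∀ a, |a - a₀| < ε →
        hingeSum d k n (Real.exp (n * a)) ≤ hingeSum c l n (Real.exp (n * a)) := by
    rintro a₀ ⟨ha1, ha2⟩
    rcases lt_or_ge a₀ (partFn' c l 1) with hac | hac
    · rcases lt_or_ge a₀ (partFn' d k 1) with had | had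
      · obtain ⟨α, hα, hαa⟩ := intermediate_value_Icc zero_le_one hμd.continuousOn
          (show a₀ ∈ Set.Icc _ _ from ⟨by linarith, by simpa [d1] using had.le⟩)
        simp only at hαa
        have hα1 : α ≠ 1 := by
          rintro rfl
          rw [d1, div_one] at hαa
          linarith
        refine local_hinge_lower hc hd c1 d1 (α := α) (β := α) hα.1 hα.2 hαa.le ?_
        rw [hαa]
        have := Real.log_lt_log (hZc α) (hlt α hα.1 (lt_of_le_of_ne hα.2 hα1))
        linarith
      · have hev := eventually_lt_left_of_deriv_pos (hasDerivAt_log_partFn c1 a₀)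
          (sub_pos.2 hac)
        obtain ⟨β, hβ, hβ1⟩ := (hev.and (Ioo_mem_nhdsLT (zero_lt_one (α := ℝ)))).exists
        refine local_hinge_lower hc hd c1 d1 (α := 1) (β := β) hβ1.1.le hβ1.2.le
          (by simpa [d1] using had) ?_
        simpa [d1, c1] using hβ
    · obtain ⟨K, hK1, hK⟩ := exists_tilted_mean_gt hc c1 hx₀ (ha2.trans_lt (hx₀' _ hy₀))
      obtain ⟨α₀, ⟨⟨hα1, hαK⟩, hα₀⟩, hgr⟩ :=
        (isCompact_Icc.inter_right (isClosed_le hμc continuous_const)).exists_isGreatest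
          (s := Set.Icc 1 K ∩ {α | partFn' c l α / partFn c l α ≤ a₀})
          ⟨1, ⟨le_rfl, hK1⟩, by simpa [c1] using hac⟩
      simp only [Set.mem_ofPred_eq] at hα₀
      have hα₀K : α₀ < K := lt_of_le_of_ne hαK (by rintro rfl; linarith)
      have hright : ∀ α ∈ Set.Ioo α₀ K, a₀ < partFn' c l α / partFn c l α := by
        intro α hα
        by_contra hcon
        exact absurd (hgr ⟨⟨hα1.trans hα.1.le, hα.2.le⟩, not_lt.1 hcon⟩) (not_le.2 hα.1)
      have hev : ∀ᶠ α in nhdsWithin α₀ (Set.Ioi α₀), α ∈ Set.Ioo α₀ K := Ioo_mem_nhdsGT hα₀K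
      have hα₀' : partFn' c l α₀ / partFn c l α₀ = a₀ :=
        le_antisymm hα₀ (ge_of_tendsto (hμc.continuousWithinAt (s := Set.Ioi α₀))
          (hev.mono fun α hα => (hright α hα).le))
      have hF : Continuous fun α => Real.log (partFn c l α) +
          (1 - α) * (partFn' c l α / partFn c l α) :=
        ((continuous_partFn c l).log fun α => (hZc α).ne').add
          ((continuous_const.sub continuous_id).mul hμc)
      obtain ⟨β, hβ, hβF⟩ : ∃ β, 1 ≤ β ∧ Real.log (partFn d k β) + (1 - β) * a₀ <
          Real.log (partFn c l α₀) + (1 - α₀) * (partFn' c l α₀ / partFn c l α₀) := by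
        rcases hα1.eq_or_lt with h1 | h1
        · have hev := eventually_lt_right_of_deriv_neg (hasDerivAt_log_partFn d1 a₀)
            (sub_neg.2 (hder.trans_le hac))
          obtain ⟨β, hβ, hβ1⟩ := (hev.and self_mem_nhdsWithin).exists
          refine ⟨β, le_of_lt hβ1, ?_⟩
          simpa [← h1, c1, d1] using hβ
        · refine ⟨α₀, hα1, ?_⟩
          rw [hα₀']
          linarith [Real.log_lt_log (hZd α₀) (hgt α₀ h1)]
      obtain ⟨α, hα, hαF⟩ := (hev.and ((hF.continuousWithinAt (s := Set.Ioi α₀)).eventually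
        (lt_mem_nhds hβF))).exists
      exact local_hinge_upper hc hd c1 d1 hβ (hright α hα) hαF
  have hmid : ∀ᶠ n : ℕ in Filter.atTop,
      ∀ a ∈ Set.Icc (partFn' d k 0 / partFn d k 0 + ε) (k y₀),
        hingeSum d k n (Real.exp (n * a)) ≤ hingeSum c l n (Real.exp (n * a)) := by
    refine isCompact_Icc.induction_on
      (p := fun s => ∀ᶠ n : ℕ in Filter.atTop, ∀ a ∈ s,
        hingeSum d k n (Real.exp (n * a)) ≤ hingeSum c l n (Real.exp (n * a))) ?_ ?_ ?_ ?_
    · simp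
    · exact fun s t hst ht => ht.mono fun n hn a ha => hn a (hst ha)
    · intro s t hs ht
      filter_upwards [hs, ht] with n h1 h2 a ha
      exact ha.elim (h1 a) (h2 a)
    · intro a₀ ha₀
      obtain ⟨δ, hδ, h⟩ := hlocal a₀ ha₀
      exact ⟨Metric.ball a₀ δ, mem_nhdsWithin_of_mem_nhds (Metric.ball_mem_nhds _ hδ),
        h.mono fun n hn a ha => hn a (by simpa [Real.dist_eq] using ha)⟩
  obtain ⟨N, hN⟩ := Filter.eventually_atTop.1 ((hleft.and hmid).and
    (Filter.eventually_ge_atTop 1))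
  refine ⟨N, fun n hn t ht => ?_⟩
  obtain ⟨⟨h1, h2⟩, hn1⟩ := hN n hn
  rcases ht.eq_or_lt with rfl | ht
  · rw [hingeSum_le_hingeSum_iff c1 d1]
    simp [truncSum, min_eq_right (Real.exp_pos _).le]
  have hn0 : (0 : ℝ) < n := by exact_mod_cast hn1
  obtain ⟨a, rfl⟩ : ∃ a : ℝ, Real.exp (n * a) = t :=
    ⟨Real.log t / n, by rw [mul_div_cancel₀ _ hn0.ne', Real.exp_log ht]⟩
  rcases le_total a (partFn' d k 0 / partFn d k 0 + ε) with ha | ha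
  · exact h1 a ha
  rcases le_total a (k y₀) with ha' | ha'
  · exact h2 a ⟨ha, ha'⟩
  · have hz : hingeSum d k n (Real.exp (n * a)) = 0 := by
      refine Finset.sum_eq_zero fun f _ => ?_
      by_cases hf : ∀ j, 0 < d (f j)
      · have : seqSum k f ≤ n * a := by
          calc seqSum k f ≤ ∑ _j : Fin n, a :=
                Finset.sum_le_sum fun j _ => (hy₀' _ (hf j)).trans ha'
            _ = n * a := by simp
        rw [max_eq_right (sub_nonpos.2 (Real.exp_le_exp.2 this)), mul_zero]
      · push Not at hf
        obtain ⟨j, hj⟩ := hf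
        rw [seqWt, Finset.prod_eq_zero (Finset.mem_univ j) (le_antisymm hj (hd _)), zero_mul]
    rw [hz]
    exact Finset.sum_nonneg fun f _ => mul_nonneg (seqWt_nonneg hc f) (le_max_right _ _)

end Asymptotics

/-- The second vector of a dichotomy restricted to the support of the first. -/
def supWt {I : Type} (p₁ p₂ : I → ℝ) (x : I) : ℝ := if p₁ x = 0 then 0 else p₂ x

/-- Log-likelihood ratio. -/
def llr {I : Type} (p₁ p₂ : I → ℝ) (x : I) : ℝ := Real.log (p₁ x / p₂ x)

namespace IsDichotomy

variable {I J : Type} [Fintype I] [Fintype J] {p₁ p₂ : I → ℝ} {q₁ q₂ : J → ℝ}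

lemma fst_pos (hp : IsDichotomy p₁ p₂) {x : I} (hx : p₁ x ≠ 0) : 0 < p₁ x :=
  lt_of_le_of_ne (hp.1.1 x) hx.symm

lemma snd_pos (hp : IsDichotomy p₁ p₂) {x : I} (hx : p₁ x ≠ 0) : 0 < p₂ x :=
  lt_of_le_of_ne (hp.2.1.1 x) (hp.2.2 x hx).symm

lemma supWt_nonneg (hp : IsDichotomy p₁ p₂) (x : I) : 0 ≤ supWt p₁ p₂ x := by
  unfold supWt
  split_ifs
  exacts [le_rfl, hp.2.1.1 x]

lemma supWt_pos_iff (hp : IsDichotomy p₁ p₂) (x : I) : 0 < supWt p₁ p₂ x ↔ p₁ x ≠ 0 := by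
  unfold supWt
  split_ifs with h
  · simp [h]
  · simpa [h] using hp.snd_pos h

lemma supWt_mul_exp_llr (hp : IsDichotomy p₁ p₂) (x : I) :
    supWt p₁ p₂ x * Real.exp (llr p₁ p₂ x) = p₁ x := by
  unfold supWt llr
  split_ifs with h
  · simp [h]
  · rw [Real.exp_log (div_pos (hp.fst_pos h) (hp.snd_pos h)),
      mul_div_cancel₀ _ (hp.snd_pos h).ne']

lemma supWt_mul_exp_mul_llr (hp : IsDichotomy p₁ p₂) {x : I} (hx : p₁ x ≠ 0) (α : ℝ) :
    supWt p₁ p₂ x * Real.exp (α * llr p₁ p₂ x) = p₂ x * (p₁ x / p₂ x) ^ α := by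
  rw [supWt, if_neg hx, Real.rpow_def_of_pos (div_pos (hp.fst_pos hx) (hp.snd_pos hx)), llr,
    mul_comm α]

lemma partFn_one (hp : IsDichotomy p₁ p₂) : partFn (supWt p₁ p₂) (llr p₁ p₂) 1 = 1 := by
  simp only [partFn, one_mul, hp.supWt_mul_exp_llr, hp.1.2]

lemma partFn_pos (hp : IsDichotomy p₁ p₂) (α : ℝ) :
    0 < partFn (supWt p₁ p₂) (llr p₁ p₂) α :=
  _root_.partFn_pos hp.supWt_nonneg (hp.partFn_one ▸ one_pos) α

lemma exists_ne (hp : IsDichotomy p₁ p₂) : ∃ x, p₁ x ≠ 0 ∧ p₂ x ≠ 0 := by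
  by_contra! h
  have : ∑ x, p₁ x = 0 := Finset.sum_eq_zero fun x _ => by
    by_contra hx
    exact hp.2.2 x hx (h x hx)
  rw [hp.1.2] at this
  exact one_ne_zero this

lemma sum_filter_rpow (hp : IsDichotomy p₁ p₂) (α : ℝ) (P : I → Prop) [DecidablePred P]
    (hP : ∀ x, P x ↔ p₁ x ≠ 0) :
    ∑ x ∈ Finset.univ.filter P, p₁ x ^ α * p₂ x ^ (1 - α) =
      partFn (supWt p₁ p₂) (llr p₁ p₂) α := by
  rw [Finset.sum_filter, partFn]
  refine Finset.sum_congr rfl fun x _ => ?_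
  by_cases hx : p₁ x = 0
  · rw [if_neg (by rw [hP]; simp [hx])]
    simp [supWt, hx]
  · rw [if_pos ((hP x).2 hx), hp.supWt_mul_exp_mul_llr hx,
      Real.div_rpow (hp.1.1 x) (hp.2.1.1 x), Real.rpow_sub (hp.snd_pos hx), Real.rpow_one]
    ring

lemma renyi_of_ne_one (hp : IsDichotomy p₁ p₂) {α : ℝ} (h1 : α ≠ 1) :
    renyi α p₁ p₂ =
      (((α - 1)⁻¹ * Real.log (partFn (supWt p₁ p₂) (llr p₁ p₂) α) : ℝ) : EReal) := by
  have hP : ∀ x, (p₁ x ≠ 0 ∧ p₂ x ≠ 0) ↔ p₁ x ≠ 0 := fun x => ⟨And.left, fun h => ⟨h, hp.2.2 x h⟩⟩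
  rw [renyi, if_neg (not_not.2 hp.exists_ne)]
  split_ifs with h0 h2 h3
  · subst h0
    rw [← hp.sum_filter_rpow 0 _ hP]
    simp
  · rw [hp.sum_filter_rpow α _ hP]
  · rw [hp.sum_filter_rpow α _ fun x => Iff.rfl]
  · exact absurd hp.2.2 h3

lemma renyi_one (hp : IsDichotomy p₁ p₂) :
    renyi 1 p₁ p₂ = ((partFn' (supWt p₁ p₂) (llr p₁ p₂) 1 : ℝ) : EReal) := by
  rw [renyi, if_neg (not_not.2 hp.exists_ne), if_neg one_ne_zero, if_neg (lt_irrefl _),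
    if_pos rfl, if_pos hp.2.2, partFn', Finset.sum_filter]
  congr 1
  refine Finset.sum_congr rfl fun x _ => ?_
  rw [one_mul, mul_left_comm, hp.supWt_mul_exp_llr, llr]
  split_ifs with h
  · ring
  · rw [not_not.1 h]; ring

lemma exists_renyiTop (hp : IsDichotomy p₁ p₂) :
    ∃ x₀, p₁ x₀ ≠ 0 ∧ (∀ x, p₁ x ≠ 0 → llr p₁ p₂ x ≤ llr p₁ p₂ x₀) ∧
      renyiTop p₁ p₂ = ((llr p₁ p₂ x₀ : ℝ) : EReal) := by
  rw [renyiTop, dif_pos hp.exists_ne, if_pos hp.2.2]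
  generalize_proofs hne
  obtain ⟨x₀, hx₀, he⟩ := Finset.exists_mem_eq_sup' hne fun x => p₁ x / p₂ x
  have hx₀' : p₁ x₀ ≠ 0 := by simpa using hx₀
  refine ⟨x₀, hx₀', fun x hx => ?_, by rw [he]; rfl⟩
  refine Real.log_le_log (div_pos (hp.fst_pos hx) (hp.snd_pos hx)) ?_
  rw [← he]
  exact Finset.le_sup' (fun x => p₁ x / p₂ x) (by simpa using hx)

lemma hinge_kpow (hp : IsDichotomy p₁ p₂) (n : ℕ) {t : ℝ} (ht : 0 ≤ t) :
    ∑ f, max (kpow p₁ n f - t * kpow p₂ n f) 0 = hingeSum (supWt p₁ p₂) (llr p₁ p₂) n t := by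
  refine Finset.sum_congr rfl fun f _ => ?_
  have h1 : kpow p₁ n f = seqWt (supWt p₁ p₂) f * Real.exp (seqSum (llr p₁ p₂) f) := by
    rw [seqWt, seqSum, Real.exp_sum, ← Finset.prod_mul_distrib]
    exact Finset.prod_congr rfl fun j _ => (hp.supWt_mul_exp_llr _).symm
  have hn : 0 ≤ kpow p₂ n f := (hp.2.1.kpow n).1 f
  by_cases hf : ∃ j, p₁ (f j) = 0
  · obtain ⟨j, hj⟩ := hf
    have h0 : seqWt (supWt p₁ p₂) f = 0 :=
      Finset.prod_eq_zero (Finset.mem_univ j) (by simp [supWt, hj])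
    rw [h1, h0, zero_mul, zero_mul, max_eq_right]
    nlinarith [mul_nonneg ht hn]
  · push Not at hf
    have h2 : kpow p₂ n f = seqWt (supWt p₁ p₂) f :=
      Finset.prod_congr rfl fun j _ => by simp [supWt, hf j]
    rw [h1, h2, mul_max_of_nonneg _ _ (h2 ▸ hn), mul_zero]
    ring_nf

lemma partFn_kron (hp : IsDichotomy p₁ p₂) (hq : IsDichotomy q₁ q₂) (α : ℝ) :
    partFn (supWt (_root_.kron p₁ q₁) (_root_.kron p₂ q₂))
        (llr (_root_.kron p₁ q₁) (_root_.kron p₂ q₂)) α =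
      partFn (supWt p₁ p₂) (llr p₁ p₂) α * partFn (supWt q₁ q₂) (llr q₁ q₂) α := by
  rw [partFn, partFn, partFn, Finset.sum_mul_sum, Fintype.sum_prod_type]
  refine Finset.sum_congr rfl fun x _ => Finset.sum_congr rfl fun y _ => ?_
  by_cases hx : p₁ x = 0
  · simp [supWt, _root_.kron, hx]
  by_cases hy : q₁ y = 0
  · simp [supWt, _root_.kron, hy]
  have hl : llr (_root_.kron p₁ q₁) (_root_.kron p₂ q₂) (x, y) =
      llr p₁ p₂ x + llr q₁ q₂ y := by
    rw [llr, llr, llr, ← Real.log_mul (div_pos (hp.fst_pos hx) (hp.snd_pos hx)).ne'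
      (div_pos (hq.fst_pos hy) (hq.snd_pos hy)).ne', _root_.kron, _root_.kron, mul_div_mul_comm]
  rw [hl, mul_add, Real.exp_add]
  simp only [supWt, _root_.kron, hx, hy, mul_eq_zero, or_self, if_false]
  ring

lemma partFn_eq_sum_rpow (hp : IsDichotomy p₁ p₂) {α : ℝ} (hα : α ≠ 0) :
    partFn (supWt p₁ p₂) (llr p₁ p₂) α = ∑ x, p₂ x * (p₁ x / p₂ x) ^ α := by
  refine Finset.sum_congr rfl fun x _ => ?_
  by_cases hx : p₁ x = 0
  · simp [supWt, hx, Real.zero_rpow hα]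
  · exact hp.supWt_mul_exp_mul_llr hx α

/-- Data processing inequality for convex divergences. -/
lemma sum_convex_le (hp : IsDichotomy p₁ p₂) (hq : IsDichotomy q₁ q₂) {T : J → I → ℝ}
    (hT : IsStoch T) (h₁ : ∀ y, ∑ x, T y x * p₁ x = q₁ y) (h₂ : ∀ y, ∑ x, T y x * p₂ x = q₂ y)
    {φ : ℝ → ℝ} (hφ : ConvexOn ℝ (Set.Ici 0) φ) :
    ∑ y, q₂ y * φ (q₁ y / q₂ y) ≤ ∑ x, p₂ x * φ (p₁ x / p₂ x) := by
  have hnn : ∀ y x, 0 ≤ T y x * p₂ x := fun y x => mul_nonneg (hT.1 y x) (hp.2.1.1 x)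
  calc ∑ y, q₂ y * φ (q₁ y / q₂ y) ≤ ∑ y, ∑ x, T y x * p₂ x * φ (p₁ x / p₂ x) := by
        refine Finset.sum_le_sum fun y _ => ?_
        rcases (hq.2.1.1 y).eq_or_lt with hy | hy
        · have hz : ∀ x, T y x * p₂ x = 0 := by
            have := h₂ y
            rw [← hy, Finset.sum_eq_zero_iff_of_nonneg fun x _ => hnn y x] at this
            exact fun x => this x (Finset.mem_univ x)
          simp [hz, ← hy]
        · have hw : ∑ x, T y x * p₂ x / q₂ y = 1 := by
            rw [← Finset.sum_div, h₂, div_self hy.ne']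
          have hJ := hφ.map_sum_le (t := Finset.univ) (w := fun x => T y x * p₂ x / q₂ y)
            (p := fun x => p₁ x / p₂ x) (fun x _ => div_nonneg (hnn y x) hy.le) hw
            (fun x _ => div_nonneg (hp.1.1 x) (hp.2.1.1 x))
          have hmean : ∑ x, (T y x * p₂ x / q₂ y) • (p₁ x / p₂ x) = q₁ y / q₂ y := by
            rw [← h₁, Finset.sum_div]
            refine Finset.sum_congr rfl fun x _ => ?_
            rw [smul_eq_mul]
            by_cases hx : p₁ x = 0
            · simp [hx]
            · have := (hp.snd_pos hx).ne'
              field_simp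
          rw [hmean] at hJ
          calc q₂ y * φ (q₁ y / q₂ y)
              ≤ q₂ y * ∑ x, (T y x * p₂ x / q₂ y) • φ (p₁ x / p₂ x) := by gcongr
            _ = _ := by
              rw [Finset.mul_sum]
              refine Finset.sum_congr rfl fun x _ => ?_
              rw [smul_eq_mul]
              field_simp
    _ = ∑ x, p₂ x * φ (p₁ x / p₂ x) := by
        rw [Finset.sum_comm]
        refine Finset.sum_congr rfl fun x _ => ?_
        rw [← Finset.sum_mul, ← Finset.sum_mul, hT.2, one_mul]

lemma partFn_mono (hp : IsDichotomy p₁ p₂) (hq : IsDichotomy q₁ q₂) {T : J → I → ℝ}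
    (hT : IsStoch T) (h₁ : ∀ y, ∑ x, T y x * p₁ x = q₁ y) (h₂ : ∀ y, ∑ x, T y x * p₂ x = q₂ y)
    {α : ℝ} (hα : 1 < α) :
    partFn (supWt q₁ q₂) (llr q₁ q₂) α ≤ partFn (supWt p₁ p₂) (llr p₁ p₂) α := by
  have h0 : α ≠ 0 := by linarith
  rw [hp.partFn_eq_sum_rpow h0, hq.partFn_eq_sum_rpow h0]
  exact hp.sum_convex_le hq hT h₁ h₂ (convexOn_rpow hα.le)

lemma partFn_anti (hp : IsDichotomy p₁ p₂) (hq : IsDichotomy q₁ q₂) {T : J → I → ℝ}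
    (hT : IsStoch T) (h₁ : ∀ y, ∑ x, T y x * p₁ x = q₁ y) (h₂ : ∀ y, ∑ x, T y x * p₂ x = q₂ y)
    {α : ℝ} (hα : 0 < α) (hα1 : α < 1) :
    partFn (supWt p₁ p₂) (llr p₁ p₂) α ≤ partFn (supWt q₁ q₂) (llr q₁ q₂) α := by
  rw [hp.partFn_eq_sum_rpow hα.ne', hq.partFn_eq_sum_rpow hα.ne']
  have := hp.sum_convex_le hq hT h₁ h₂ (Real.concaveOn_rpow hα.le hα1.le).neg
  simpa using this

/-- Comparison of the partition functions away from the limiting orders implies comparison of all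
Rényi divergences. -/
lemma renyi_le (hp : IsDichotomy p₁ p₂) (hq : IsDichotomy q₁ q₂)
    (hgt : ∀ α, 1 < α →
      partFn (supWt q₁ q₂) (llr q₁ q₂) α ≤ partFn (supWt p₁ p₂) (llr p₁ p₂) α)
    (hlt : ∀ α, 0 < α → α < 1 →
      partFn (supWt p₁ p₂) (llr p₁ p₂) α ≤ partFn (supWt q₁ q₂) (llr q₁ q₂) α) :
    (∀ α : ℝ, 0 ≤ α → renyi α q₁ q₂ ≤ renyi α p₁ p₂) ∧ renyiTop q₁ q₂ ≤ renyiTop p₁ p₂ := by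
  have h0 : partFn (supWt p₁ p₂) (llr p₁ p₂) 0 ≤ partFn (supWt q₁ q₂) (llr q₁ q₂) 0 :=
    le_of_tendsto_of_tendsto
      ((continuous_partFn _ _).continuousWithinAt (s := Set.Ioi 0) (x := 0))
      ((continuous_partFn _ _).continuousWithinAt (s := Set.Ioi 0) (x := 0))
      (Filter.mem_of_superset (Ioo_mem_nhdsGT (zero_lt_one (α := ℝ)))
        fun α hα => hlt α hα.1 hα.2)
  refine ⟨fun α hα => ?_, ?_⟩
  · rcases lt_trichotomy α 1 with h1 | rfl | h1
    · rw [hp.renyi_of_ne_one h1.ne, hq.renyi_of_ne_one h1.ne, EReal.coe_le_coe_iff]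
      refine mul_le_mul_of_nonpos_left (Real.log_le_log (hp.partFn_pos α) ?_)
        (inv_nonpos.2 (by linarith))
      rcases hα.eq_or_lt with rfl | hα
      · exact h0
      · exact hlt α hα h1
    · rw [hp.renyi_one, hq.renyi_one, EReal.coe_le_coe_iff]
      by_contra! hcon
      have hd := (hasDerivAt_partFn (supWt p₁ p₂) (llr p₁ p₂) 1).sub
        (hasDerivAt_partFn (supWt q₁ q₂) (llr q₁ q₂) 1)
      obtain ⟨α, hα, hα1⟩ := ((eventually_lt_right_of_deriv_neg hd (sub_neg.2 hcon)).and
        self_mem_nhdsWithin).exists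
      simp only [Pi.sub_apply, hp.partFn_one, hq.partFn_one, sub_self] at hα
      linarith [hgt α hα1]
    · rw [hp.renyi_of_ne_one h1.ne', hq.renyi_of_ne_one h1.ne', EReal.coe_le_coe_iff]
      exact mul_le_mul_of_nonneg_left (Real.log_le_log (hq.partFn_pos α) (hgt α h1))
        (inv_nonneg.2 (by linarith))
  · obtain ⟨x₀, hx₀, hx₀m, hx₀e⟩ := hp.exists_renyiTop
    obtain ⟨y₀, hy₀, hy₀m, hy₀e⟩ := hq.exists_renyiTop
    rw [hx₀e, hy₀e, EReal.coe_le_coe_iff]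
    by_contra! hcon
    have ht : Filter.Tendsto
        (fun α : ℝ => supWt q₁ q₂ y₀ * Real.exp (α * (llr q₁ q₂ y₀ - llr p₁ p₂ x₀)))
        Filter.atTop Filter.atTop :=
      (Real.tendsto_exp_atTop.comp
        (Filter.tendsto_id.atTop_mul_const (sub_pos.2 hcon))).const_mul_atTop
        ((hq.supWt_pos_iff y₀).2 hy₀)
    obtain ⟨α, hα, hα1⟩ := ((ht.eventually_gt_atTop (∑ x, supWt p₁ p₂ x)).and
      (Filter.eventually_gt_atTop 1)).exists
    have e1 : supWt q₁ q₂ y₀ * Real.exp (α * llr q₁ q₂ y₀) ≤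
        partFn (supWt q₁ q₂) (llr q₁ q₂) α :=
      Finset.single_le_sum (f := fun y => supWt q₁ q₂ y * Real.exp (α * llr q₁ q₂ y))
        (fun y _ => mul_nonneg (hq.supWt_nonneg y) (Real.exp_pos _).le) (Finset.mem_univ y₀)
    have e2 : partFn (supWt p₁ p₂) (llr p₁ p₂) α ≤
        (∑ x, supWt p₁ p₂ x) * Real.exp (α * llr p₁ p₂ x₀) := by
      rw [partFn, Finset.sum_mul]
      refine Finset.sum_le_sum fun x _ => ?_
      by_cases hx : p₁ x = 0
      · simp [supWt, hx]
      · exact mul_le_mul_of_nonneg_left (Real.exp_le_exp.2 (mul_le_mul_of_nonneg_left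
          (hx₀m x hx) (by linarith))) (hp.supWt_nonneg x)
    have e3 := mul_lt_mul_of_pos_right hα (Real.exp_pos (α * llr p₁ p₂ x₀))
    have e4 : supWt q₁ q₂ y₀ * Real.exp (α * (llr q₁ q₂ y₀ - llr p₁ p₂ x₀)) *
        Real.exp (α * llr p₁ p₂ x₀) = supWt q₁ q₂ y₀ * Real.exp (α * llr q₁ q₂ y₀) := by
      rw [mul_assoc, ← Real.exp_add]; ring_nf
    linarith [hgt α hα1]

lemma renyi_le_of_catalytic {R : Type} [Fintype R] {r₁ r₂ : R → ℝ} (hr : IsDichotomy r₁ r₂)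
    (hp : IsDichotomy p₁ p₂) (hq : IsDichotomy q₁ q₂) {T : R × J → R × I → ℝ} (hT : IsStoch T)
    (h₁ : ∀ y, ∑ x, T y x * _root_.kron r₁ p₁ x = _root_.kron r₁ q₁ y)
    (h₂ : ∀ y, ∑ x, T y x * _root_.kron r₂ p₂ x = _root_.kron r₂ q₂ y) :
    (∀ α : ℝ, 0 ≤ α → renyi α q₁ q₂ ≤ renyi α p₁ p₂) ∧ renyiTop q₁ q₂ ≤ renyiTop p₁ p₂ := by
  refine hp.renyi_le hq (fun α hα => ?_) (fun α hα hα1 => ?_)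
  · have := (hr.kron hp).partFn_mono (hr.kron hq) hT h₁ h₂ hα
    rw [hr.partFn_kron hp, hr.partFn_kron hq] at this
    exact le_of_mul_le_mul_left this (hr.partFn_pos α)
  · have := (hr.kron hp).partFn_anti (hr.kron hq) hT h₁ h₂ hα hα1
    rw [hr.partFn_kron hp, hr.partFn_kron hq] at this
    exact le_of_mul_le_mul_left this (hr.partFn_pos α)

lemma eventually_hinge_kpow_le (hp : IsDichotomy p₁ p₂) (hq : IsDichotomy q₁ q₂)
    (h : ∀ α : ℝ, 0 ≤ α → renyi α q₁ q₂ < renyi α p₁ p₂)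
    (htop : renyiTop q₁ q₂ < renyiTop p₁ p₂) :
    ∃ N : ℕ, ∀ n ≥ N, ∀ t : ℝ, 0 ≤ t →
      ∑ g, max (kpow q₁ n g - t * kpow q₂ n g) 0 ≤
        ∑ f, max (kpow p₁ n f - t * kpow p₂ n f) 0 := by
  suffices hs : ∃ N : ℕ, ∀ n ≥ N, ∀ t : ℝ, 0 ≤ t →
      hingeSum (supWt q₁ q₂) (llr q₁ q₂) n t ≤ hingeSum (supWt p₁ p₂) (llr p₁ p₂) n t by
    obtain ⟨N, hN⟩ := hs
    refine ⟨N, fun n hn t ht => ?_⟩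
    rw [hp.hinge_kpow n ht, hq.hinge_kpow n ht]
    exact hN n hn t ht
  refine eventually_hingeSum_le hp.supWt_nonneg hq.supWt_nonneg hp.partFn_one
    hq.partFn_one ?_ ?_ ?_ ?_
  · intro α h0 h1
    have := h α h0
    rw [hp.renyi_of_ne_one h1.ne, hq.renyi_of_ne_one h1.ne, EReal.coe_lt_coe_iff] at this
    exact (Real.log_lt_log_iff (hp.partFn_pos α) (hq.partFn_pos α)).1
      ((mul_lt_mul_left_of_neg (inv_lt_zero.2 (by linarith))).1 this)
  · intro α h1
    have := h α (by linarith)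
    rw [hp.renyi_of_ne_one h1.ne', hq.renyi_of_ne_one h1.ne', EReal.coe_lt_coe_iff] at this
    exact (Real.log_lt_log_iff (hq.partFn_pos α) (hp.partFn_pos α)).1
      (lt_of_mul_lt_mul_left this (inv_nonneg.2 (by linarith)))
  · have := h 1 zero_le_one
    rwa [hp.renyi_one, hq.renyi_one, EReal.coe_lt_coe_iff] at this
  · obtain ⟨x₀, hx₀, -, hx₀e⟩ := hp.exists_renyiTop
    obtain ⟨y₀, -, hy₀m, hy₀e⟩ := hq.exists_renyiTop
    rw [hx₀e, hy₀e, EReal.coe_lt_coe_iff] at htop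
    exact ⟨x₀, (hp.supWt_pos_iff x₀).2 hx₀, fun y hy =>
      (hy₀m y ((hq.supWt_pos_iff y).1 hy)).trans_lt htop⟩

lemma exists_catVec_stoch (hp : IsDichotomy p₁ p₂) (hq : IsDichotomy q₁ q₂) (n : ℕ)
    (h : ∀ t : ℝ, 0 ≤ t → ∑ g, max (kpow q₁ (n + 1) g - t * kpow q₂ (n + 1) g) 0 ≤
      ∑ f, max (kpow p₁ (n + 1) f - t * kpow p₂ (n + 1) f) 0) :
    ∃ T : CatIdx I J n × J → CatIdx I J n × I → ℝ, IsStoch T ∧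
      (∀ y, ∑ x, T y x * _root_.kron (_root_.catVec n p₁ q₁) p₁ x =
        _root_.kron (_root_.catVec n p₁ q₁) q₁ y) ∧
      (∀ y, ∑ x, T y x * _root_.kron (_root_.catVec n p₂ q₂) p₂ x =
        _root_.kron (_root_.catVec n p₂ q₂) q₂ y) := by
  have hr := hp.catVec hq n
  exact exists_stoch_of_hinge (hr.1.kron hp.1) (hr.2.1.kron hp.2.1) (hr.1.kron hq.1)
    (hr.2.1.kron hq.2.1) fun t ht => hinge_catVec_le p₁ p₂ q₁ q₂ n t (h t ht)

end IsDichotomy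

/-- Corollary for dichotomies, exact regime.  Let `(p₁,p₂)` and
`(q₁,q₂)` be dichotomies.  If `D_α(p₁‖p₂) > D_α(q₁‖q₂)` for all `α ∈ [0,∞)` and for
`α = ∞`, then (a) catalytic majorization holds, and there is `n` for which the
binomial catalyst works, and (b) large-sample majorization holds for all large `n`.
Conversely, (a) (for any dichotomy catalyst) or (b) (for some `n ≥ 1`) implies the
non-strict inequalities for all `α ∈ [0,∞]`. -/
theorem stmt16 {I J : Type} [Fintype I] [Fintype J]
    (p₁ p₂ : I → ℝ) (q₁ q₂ : J → ℝ)
    (hp : IsDichotomy p₁ p₂) (hq : IsDichotomy q₁ q₂) :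
    (((∀ α : ℝ, 0 ≤ α → renyi α q₁ q₂ < renyi α p₁ p₂) ∧
        renyiTop q₁ q₂ < renyiTop p₁ p₂) →
      ((∃ (R : Type) (_ : Fintype R) (r₁ r₂ : R → ℝ), IsDichotomy r₁ r₂ ∧
          ∃ T : R × J → R × I → ℝ, IsStoch T ∧
            (∀ y, ∑ x, T y x * kron r₁ p₁ x = kron r₁ q₁ y) ∧
            (∀ y, ∑ x, T y x * kron r₂ p₂ x = kron r₂ q₂ y)) ∧
       (∃ n : ℕ,
          ∃ T : CatIdx I J n × J → CatIdx I J n × I → ℝ, IsStoch T ∧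
            (∀ y, ∑ x, T y x * kron (catVec n p₁ q₁) p₁ x = kron (catVec n p₁ q₁) q₁ y) ∧
            (∀ y, ∑ x, T y x * kron (catVec n p₂ q₂) p₂ x = kron (catVec n p₂ q₂) q₂ y)) ∧
       (∃ N : ℕ, ∀ n ≥ N,
          ∃ T : (Fin n → J) → (Fin n → I) → ℝ, IsStoch T ∧
            (∀ g, ∑ f, T g f * kpow p₁ n f = kpow q₁ n g) ∧
            (∀ g, ∑ f, T g f * kpow p₂ n f = kpow q₂ n g)))) ∧
    (((∃ (R : Type) (_ : Fintype R) (r₁ r₂ : R → ℝ), IsDichotomy r₁ r₂ ∧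
          ∃ T : R × J → R × I → ℝ, IsStoch T ∧
            (∀ y, ∑ x, T y x * kron r₁ p₁ x = kron r₁ q₁ y) ∧
            (∀ y, ∑ x, T y x * kron r₂ p₂ x = kron r₂ q₂ y)) ∨
      (∃ n : ℕ, 1 ≤ n ∧
          ∃ T : (Fin n → J) → (Fin n → I) → ℝ, IsStoch T ∧
            (∀ g, ∑ f, T g f * kpow p₁ n f = kpow q₁ n g) ∧
            (∀ g, ∑ f, T g f * kpow p₂ n f = kpow q₂ n g))) →
      ((∀ α : ℝ, 0 ≤ α → renyi α q₁ q₂ ≤ renyi α p₁ p₂) ∧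
        renyiTop q₁ q₂ ≤ renyiTop p₁ p₂)) := by
  refine ⟨?_, ?_⟩
  · rintro ⟨h, htop⟩
    obtain ⟨N, hN⟩ := hp.eventually_hinge_kpow_le hq h htop
    have hcat := hp.exists_catVec_stoch hq N (hN (N + 1) N.le_succ)
    exact ⟨⟨CatIdx I J N, inferInstance, catVec N p₁ q₁, catVec N p₂ q₂, hp.catVec hq N, hcat⟩,
      ⟨N, hcat⟩, N, fun n hn => exists_stoch_of_hinge (hp.1.kpow n) (hp.2.1.kpow n)
        (hq.1.kpow n) (hq.2.1.kpow n) (hN n hn)⟩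
  · rintro (⟨R, _, r₁, r₂, hr, T, hT, h₁, h₂⟩ | ⟨n, hn, T, hT, h₁, h₂⟩)
    · exact hr.renyi_le_of_catalytic hp hq hT h₁ h₂
    · obtain ⟨m, rfl⟩ := Nat.exists_eq_add_of_le' hn
      obtain ⟨S, hS, e₁, e₂⟩ := hp.exists_catVec_stoch hq m
        fun t _ => hinge_le_of_stoch hT h₁ h₂ t
      exact (hp.catVec hq m).renyi_le_of_catalytic hp hq hS e₁ e₂
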